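/- arXiv:2509.23026 — 3 statements merged into one kernel-verified Lean document; each statement's English description precedes it below -/
import Mathlib

section
/- Every finite multi-objective Markov game admits a stochastic Pareto-Nash Equilibrium: there exists a product policy π* = (π*_1, …, π*_N) such that for every agent k there is no policy π_k for which V_{k,1}^{(π_k, π*_{-k})}(s_1) Pareto dominates V_{k,1}^{π*}(s_1). -/
open Finset

/-- A finite-horizon `N`-player multi-objective Markov game with `M` objectives,
horizon `H`, finite state space `S` and finite action sets `A j`. -/
structure MOMG (N M H : ℕ) (S : Type) (A : Fin N → Type) [Fintype S]
    [∀ j, Fintype (A j)] where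
  /-- transition kernels `P_h : S × A → Δ(S)` -/
  P : Fin H → S → ((j : Fin N) → A j) → S → ℝ
  P_nonneg : ∀ h s a s', 0 ≤ P h s a s'
  P_sum_one : ∀ h s a, ∑ s', P h s a s' = 1
  /-- vector rewards `r_{j,h} : S × A → [0,1]^M` -/
  r : Fin N → Fin H → S → ((j : Fin N) → A j) → Fin M → ℝ
  r_nonneg : ∀ j h s a i, 0 ≤ r j h s a i
  r_le_one : ∀ j h s a i, r j h s a i ≤ 1

variable {N M H : ℕ} {S : Type} {A : Fin N → Type} [Fintype S] [∀ j, Fintype (A j)]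

/-- A Markov stochastic policy: a decision rule `S → Δ(α)` for each step. -/
def IsPolicy {H : ℕ} {S α : Type} [Fintype α] (ρ : Fin H → S → α → ℝ) : Prop :=
  ∀ h s, (∀ a, 0 ≤ ρ h s a) ∧ ∑ a, ρ h s a = 1

/-- A product policy: each agent plays a Markov stochastic policy. -/
def IsProductPolicy (π : (j : Fin N) → Fin H → S → A j → ℝ) : Prop :=
  ∀ j, IsPolicy (π j)

/-- Value vector of agent `k` under the product policy `π`, computed by backward
recursion on the number `t` of remaining steps; step index is `H - t`. -/
noncomputable def Vvec (G : MOMG N M H S A) (k : Fin N)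
    (π : (j : Fin N) → Fin H → S → A j → ℝ) : ℕ → S → Fin M → ℝ
  | 0, _, _ => 0
  | (t+1), s, i =>
    if ht : H - (t+1) < H then
      ∑ a : (j : Fin N) → A j, (∏ j, π j ⟨H - (t+1), ht⟩ s (a j)) *
        (G.r k ⟨H - (t+1), ht⟩ s a i +
          ∑ s', G.P ⟨H - (t+1), ht⟩ s a s' * Vvec G k π t s' i)
    else 0

/-- `V_{k,1}^π(s_1) ∈ ℝ^M`. -/
noncomputable def ValueVec (G : MOMG N M H S A) (k : Fin N)
    (π : (j : Fin N) → Fin H → S → A j → ℝ) (s1 : S) : Fin M → ℝ :=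
  fun i => Vvec G k π H s1 i

/-- `u` Pareto dominates `v`. -/
def ParetoDom {M : ℕ} (u v : Fin M → ℝ) : Prop :=
  (∀ i, v i ≤ u i) ∧ ∃ i, v i < u i

/-- `u` strictly Pareto dominates `v`. -/
def StrictParetoDom {M : ℕ} (u v : Fin M → ℝ) : Prop :=
  ∀ i, v i < u i

/-- the closed probability simplex Δ_M -/
def InSimplex {M : ℕ} (l : Fin M → ℝ) : Prop :=
  (∀ i, 0 ≤ l i) ∧ ∑ i, l i = 1

/-- the relative interior Δ_M^o of the simplex -/
def InOpenSimplex {M : ℕ} (l : Fin M → ℝ) : Prop :=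
  (∀ i, 0 < l i) ∧ ∑ i, l i = 1

/-- Pareto-Nash Equilibrium: no agent has a unilateral (Markov stochastic)
deviation whose value vector Pareto dominates its value under `π`. -/
def IsPNE (G : MOMG N M H S A) (s1 : S)
    (π : (j : Fin N) → Fin H → S → A j → ℝ) : Prop :=
  ∀ k, ∀ ρ : Fin H → S → A k → ℝ, IsPolicy ρ →
    ¬ ParetoDom (ValueVec G k (Function.update π k ρ) s1) (ValueVec G k π s1)

/-- Weak Pareto-Nash Equilibrium: no unilateral deviation strictly Pareto
dominates. -/
def IsWPNE (G : MOMG N M H S A) (s1 : S)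
    (π : (j : Fin N) → Fin H → S → A j → ℝ) : Prop :=
  ∀ k, ∀ ρ : Fin H → S → A k → ℝ, IsPolicy ρ →
    ¬ StrictParetoDom (ValueVec G k (Function.update π k ρ) s1) (ValueVec G k π s1)

/-- Nash equilibrium of the linearly scalarized game `G_Λ`. -/
def IsScalarizedNE (G : MOMG N M H S A) (s1 : S) (lam : Fin N → Fin M → ℝ)
    (π : (j : Fin N) → Fin H → S → A j → ℝ) : Prop :=
  ∀ k, ∀ ρ : Fin H → S → A k → ℝ, IsPolicy ρ →
    ∑ i, lam k i * ValueVec G k (Function.update π k ρ) s1 i ≤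
      ∑ i, lam k i * ValueVec G k π s1 i

section Brouwer

open Set Metric MeasureTheory Topology
open scoped RealInnerProductSpace

theorem exists_polynomial_eval_eq_det_one_add_smul {E : Type*} [NormedAddCommGroup E]
    [NormedSpace ℝ E] [FiniteDimensional ℝ E] (A : E →L[ℝ] E) :
    ∃ p : Polynomial ℝ, p.natDegree ≤ Module.finrank ℝ E ∧
      ∀ t : ℝ, (1 + t • A).det = p.eval t := by
  let b := Module.finBasis ℝ E
  let B := LinearMap.toMatrix b b A.toLinearMap
  refine ⟨_, (Polynomial.natDegree_det_X_add_C_le B 1).trans_eq (Fintype.card_fin _), fun t => ?_⟩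
  have hmat : LinearMap.toMatrix b b (1 + t • A : E →L[ℝ] E).toLinearMap = t • B + 1 := by
    have h1 : (1 + t • A : E →L[ℝ] E).toLinearMap = t • A.toLinearMap + LinearMap.id := by
      ext x; simp [add_comm]
    rw [h1, map_add, map_smul, LinearMap.toMatrix_id]
  rw [ContinuousLinearMap.det, ← LinearMap.det_toMatrix b, hmat, ← Polynomial.coe_evalRingHom,
    RingHom.map_det]
  congr 1
  ext i j
  simp [Matrix.one_apply, mul_comm t]
  split_ifs <;> simp

theorem exists_interpolation_det_one_add {E : Type*} [NormedAddCommGroup E]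
    [NormedSpace ℝ E] [FiniteDimensional ℝ E] {ε : ℝ} (hε : 0 < ε) :
    ∃ (n : ℕ) (t c : Fin n → ℝ), (∀ i, 0 ≤ t i ∧ t i < ε) ∧
      ∀ A : E →L[ℝ] E, (1 + A).det = ∑ i, c i * (1 + t i • A).det := by
  classical
  let n := Module.finrank ℝ E + 1
  let t : Fin n → ℝ := fun i => ε * (i / n)
  have hn : (0 : ℝ) < n := by positivity
  have ht : Function.Injective t := by
    intro i j hij
    have := mul_left_cancel₀ hε.ne' hij
    rw [div_left_inj' hn.ne'] at this
    exact Fin.ext (by exact_mod_cast this)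
  refine ⟨n, t, fun i => (Lagrange.basis Finset.univ t i).eval 1, fun i => ⟨by positivity, ?_⟩,
    fun A => ?_⟩
  · have : (i : ℝ) / n < 1 := by
      rw [div_lt_one hn]; exact_mod_cast i.2
    exact (mul_lt_mul_of_pos_left this hε).trans_eq (mul_one _)
  · obtain ⟨p, hp, hpe⟩ := exists_polynomial_eval_eq_det_one_add_smul A
    have h1 : (1 + A).det = p.eval 1 := by rw [← hpe 1, one_smul]
    have hdeg : p.degree < (Finset.univ : Finset (Fin n)).card := by
      rw [Finset.card_univ, Fintype.card_fin]
      exact p.degree_le_natDegree.trans_lt (by exact_mod_cast Nat.lt_succ_of_le hp)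
    have h2 := congrArg (Polynomial.eval 1) (Lagrange.eq_interpolate ht.injOn hdeg)
    rw [h1, h2, Lagrange.interpolate_apply, Polynomial.eval_finsetSum]
    refine Finset.sum_congr rfl fun i _ => ?_
    rw [Polynomial.eval_mul, Polynomial.eval_C, hpe, mul_comm]

variable {E : Type*} [NormedAddCommGroup E] [InnerProductSpace ℝ E] [FiniteDimensional ℝ E]

theorem det_one_add_pos_of_norm_lt_one (A : E →L[ℝ] E) (hA : ‖A‖ < 1) : 0 < (1 + A).det := by
  have hne : ∀ s ∈ Icc (0 : ℝ) 1, (1 + s • A).det ≠ 0 := by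
    intro s hs h0
    have hinj : Function.Injective (1 + s • A : E →L[ℝ] E).toLinearMap := by
      rw [injective_iff_map_eq_zero]
      intro x hx
      by_contra hx0
      have hx' : x = -(s • A x) := by
        have : x + s • A x = 0 := by simpa using hx
        exact eq_neg_of_add_eq_zero_left this
      have : ‖x‖ < ‖x‖ := calc
        ‖x‖ = |s| * ‖A x‖ := by conv_lhs => rw [hx', norm_neg, norm_smul, Real.norm_eq_abs]
        _ ≤ 1 * (‖A‖ * ‖x‖) := by
          gcongr
          · rw [abs_of_nonneg hs.1]; exact hs.2
          · exact A.le_opNorm x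
        _ < ‖x‖ := by
          rw [one_mul]
          exact mul_lt_of_lt_one_left (norm_pos_iff.mpr hx0) hA
      exact lt_irrefl _ this
    have := LinearMap.isUnit_iff_ker_eq_bot (1 + s • A : E →L[ℝ] E).toLinearMap |>.2
      (LinearMap.ker_eq_bot.2 hinj)
    have := (LinearMap.isUnit_iff_isUnit_det _).1 this
    exact this.ne_zero h0
  have hcont : ContinuousOn (fun s : ℝ => (1 + s • A).det) (Icc 0 1) :=
    (ContinuousLinearMap.continuous_det.comp (by fun_prop)).continuousOn
  by_contra hneg
  have h0 : (1 + (0 : ℝ) • A).det = 1 := by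
    simp [ContinuousLinearMap.det, ContinuousLinearMap.one_def]
  have := intermediate_value_Icc' zero_le_one hcont
  obtain ⟨s, hs, hs0⟩ := this (show (0 : ℝ) ∈ _ from ⟨by simpa using hneg, h0.symm ▸ zero_le_one⟩)
  exact hne s hs hs0

theorem image_ball_id_add_smul_eq {g : E → E} {K t : ℝ}
    (hg : ∀ x ∈ closedBall (0 : E) 1, ContDiffAt ℝ 1 g x)
    (hK : ∀ x ∈ closedBall (0 : E) 1, ‖fderiv ℝ g x‖ ≤ K)
    (hmaps : ∀ x ∈ closedBall (0 : E) 1, ‖x + g x‖ ≤ 1)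
    (hsphere : ∀ x ∈ sphere (0 : E) 1, g x = 0) (ht : 0 ≤ t) (htK : t * K < 1) (ht1 : t < 1) :
    InjOn (fun x => x + t • g x) (ball 0 1) ∧ (fun x => x + t • g x) '' ball 0 1 = ball 0 1 ∧
      ∀ x ∈ ball (0 : E) 1, 0 < (1 + t • fderiv ℝ g x).det := by
  have hdet : ∀ x ∈ ball (0 : E) 1, 0 < (1 + t • fderiv ℝ g x).det := by
    intro x hx
    refine det_one_add_pos_of_norm_lt_one _ (lt_of_le_of_lt ?_ htK)
    rw [norm_smul, Real.norm_of_nonneg ht]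
    exact mul_le_mul_of_nonneg_left (hK x (ball_subset_closedBall hx)) ht
  have hinj : InjOn (fun x => x + t • g x) (closedBall 0 1) := by
    intro x hx y hy hxy
    have h1 : ‖g y - g x‖ ≤ K * ‖y - x‖ :=
      (convex_closedBall (0 : E) 1).norm_image_sub_le_of_norm_fderiv_le
        (fun z hz => (hg z hz).differentiableAt one_ne_zero) hK hx hy
    by_contra hne
    have hpos : 0 < ‖y - x‖ := norm_pos_iff.2 (sub_ne_zero.2 (Ne.symm hne))
    have h2 : y - x = -(t • (g y - g x)) := by
      have : x + t • g x = y + t • g y := hxy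
      rw [smul_sub, neg_sub, sub_eq_sub_iff_add_eq_add, this.symm, add_comm]
    have : ‖y - x‖ < ‖y - x‖ := calc
      ‖y - x‖ = t * ‖g y - g x‖ := by
        conv_lhs => rw [h2, norm_neg, norm_smul, Real.norm_of_nonneg ht]
      _ ≤ t * (K * ‖y - x‖) := mul_le_mul_of_nonneg_left h1 ht
      _ = (t * K) * ‖y - x‖ := by ring
      _ < ‖y - x‖ := mul_lt_of_lt_one_left hpos htK
    exact lt_irrefl _ this
  have hcont : ContinuousOn (fun x => x + t • g x) (closedBall 0 1) := fun x hx =>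
    (continuousAt_id.add ((hg x hx).continuousAt.const_smul t)).continuousWithinAt
  have hsub : (fun x => x + t • g x) '' ball 0 1 ⊆ ball 0 1 := by
    rintro _ ⟨x, hx, rfl⟩
    rw [mem_ball_zero_iff] at hx ⊢
    have h : x + t • g x = (1 - t) • x + t • (x + g x) := by module
    calc ‖x + t • g x‖ ≤ ‖(1 - t) • x‖ + ‖t • (x + g x)‖ := h ▸ norm_add_le _ _
      _ = (1 - t) * ‖x‖ + t * ‖x + g x‖ := by
        rw [norm_smul, norm_smul, Real.norm_of_nonneg ht, Real.norm_of_nonneg (by linarith)]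
      _ ≤ (1 - t) * ‖x‖ + t * 1 := by
        gcongr
        exact hmaps x (by simpa using hx.le)
      _ < 1 := by nlinarith
  refine ⟨hinj.mono ball_subset_closedBall, hsub.antisymm ?_, hdet⟩
  refine (convex_ball (0 : E) 1).isPreconnected.subset_of_closure_inter_subset ?_ ?_ ?_
  · rw [isOpen_iff_mem_nhds]
    rintro _ ⟨x, hx, rfl⟩
    have hstrict : HasStrictFDerivAt (fun x => x + t • g x) (1 + t • fderiv ℝ g x) x :=
      (hasStrictFDerivAt_id x).add
        (((hg x (ball_subset_closedBall hx)).hasStrictFDerivAt one_ne_zero).const_smul t)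
    have hsurj : (1 + t • fderiv ℝ g x).range = ⊤ :=
      (LinearMap.isUnit_iff_range_eq_top _).1
        ((LinearMap.isUnit_iff_isUnit_det _).2 (hdet x hx).ne'.isUnit)
    rw [← hstrict.map_nhds_eq_of_surj hsurj]
    exact Filter.image_mem_map (isOpen_ball.mem_nhds hx)
  · have h0 : (0 : E) ∈ ball (0 : E) 1 := mem_ball_self one_pos
    exact ⟨_, hsub (mem_image_of_mem _ h0), mem_image_of_mem _ h0⟩
  · rintro y ⟨hy, hyb⟩
    have hcl : IsClosed ((fun x => x + t • g x) '' closedBall 0 1) :=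
      ((isCompact_closedBall 0 1).image_of_continuousOn hcont).isClosed
    obtain ⟨x, hx, rfl⟩ := closure_minimal (image_mono ball_subset_closedBall) hcl hy
    rcases (mem_closedBall_zero_iff.1 hx).lt_or_eq with h | h
    · exact mem_image_of_mem _ (mem_ball_zero_iff.2 h)
    · have := hsphere x (mem_sphere_zero_iff_norm.2 h)
      simp [this, h] at hyb

theorem not_exists_contDiff_retraction_sphere (r : E → E)
    (hr : ∀ x ∈ closedBall (0 : E) 1, ContDiffAt ℝ 1 r x)
    (hnorm : ∀ x ∈ closedBall (0 : E) 1, ‖r x‖ = 1)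
    (hid : ∀ x ∈ sphere (0 : E) 1, r x = x) : False := by
  borelize E
  let μ : Measure E := Measure.addHaar
  let g : E → E := fun x => r x - x
  have hg : ∀ x ∈ closedBall (0 : E) 1, ContDiffAt ℝ 1 g x := fun x hx =>
    (hr x hx).sub contDiffAt_id
  have hg' : ContinuousOn (fderiv ℝ g) (closedBall 0 1) := fun x hx =>
    ((hg x hx).fderiv_right (m := 0) (by simp)).continuousAt.continuousWithinAt
  obtain ⟨K, hK⟩ := (isCompact_closedBall (0 : E) 1).exists_bound_of_continuousOn hg'
  have hK0 : 0 ≤ K := (norm_nonneg _).trans (hK 0 (mem_closedBall_self zero_le_one))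
  have hε : 0 < 1 / (K + 1) := by positivity
  obtain ⟨n, t, c, ht, hc⟩ := exists_interpolation_det_one_add (E := E) hε
  have hvol : ∀ i, ∫ x in ball (0 : E) 1, (1 + t i • fderiv ℝ g x).det ∂μ =
      ∫ x in ball (0 : E) 1, (1 : ℝ) ∂μ := by
    intro i
    have hti := (lt_div_iff₀ (by positivity)).1 (ht i).2
    obtain ⟨hinj, himg, hpos⟩ := image_ball_id_add_smul_eq (t := t i) hg hK
      (fun x hx => by simp [g, hnorm x hx]) (fun x hx => by simp [g, hid x hx]) (ht i).1
      (by nlinarith [(ht i).1]) (by nlinarith [mul_nonneg (ht i).1 hK0])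
    have hder : ∀ x ∈ ball (0 : E) 1, HasFDerivWithinAt (fun x => x + t i • g x)
        (1 + t i • fderiv ℝ g x) (ball 0 1) x := fun x hx =>
      ((hasFDerivAt_id x).add ((((hg x (ball_subset_closedBall hx)).differentiableAt
        one_ne_zero).hasFDerivAt).const_smul (t i))).hasFDerivWithinAt
    have h := integral_image_eq_integral_abs_det_fderiv_smul μ measurableSet_ball hder hinj
      (fun _ => (1 : ℝ))
    rw [himg] at h
    rw [h]
    refine setIntegral_congr_fun measurableSet_ball fun x hx => ?_
    simp [abs_of_pos (hpos x hx)]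
  have hint : ∀ i, IntegrableOn (fun x => (1 + t i • fderiv ℝ g x).det) (ball (0 : E) 1) μ := by
    intro i
    refine IntegrableOn.mono_set (ContinuousOn.integrableOn_compact (isCompact_closedBall 0 1) ?_)
      ball_subset_closedBall
    exact ContinuousLinearMap.continuous_det.comp_continuousOn
      (continuousOn_const.add (hg'.const_smul (t i)))
  have hsum : ∑ i, c i = 1 := by
    have := hc 0
    simpa [ContinuousLinearMap.det, ContinuousLinearMap.one_def] using this.symm
  have hfinal : ∫ x in ball (0 : E) 1, (1 + fderiv ℝ g x).det ∂μ =
      ∫ x in ball (0 : E) 1, (1 : ℝ) ∂μ := by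
    rw [integral_congr_ae (Filter.Eventually.of_forall fun x => hc (fderiv ℝ g x)),
      integral_finsetSum _ fun i _ => (hint i).const_mul (c i)]
    simp_rw [integral_const_mul, hvol]
    rw [← Finset.sum_mul, hsum, one_mul]
  have hzero : ∀ x ∈ ball (0 : E) 1, (1 + fderiv ℝ g x).det = 0 := by
    intro x hx
    have hrd := ((hr x (ball_subset_closedBall hx)).differentiableAt one_ne_zero).hasFDerivAt
    have hfg : 1 + fderiv ℝ g x = fderiv ℝ r x := by
      have : fderiv ℝ g x = fderiv ℝ r x - 1 := (hrd.sub (hasFDerivAt_id x)).fderiv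
      rw [this]; abel
    rw [hfg]
    by_contra hne
    have hsurj := LinearMap.range_eq_top.1 ((LinearMap.isUnit_iff_range_eq_top _).1
      ((LinearMap.isUnit_iff_isUnit_det (fderiv ℝ r x).toLinearMap).2 (Ne.isUnit hne)))
    obtain ⟨v, hv⟩ := hsurj (r x)
    have hconst : (fun y => ‖r y‖ ^ 2) =ᶠ[𝓝 x] fun _ => (1 : ℝ) := by
      filter_upwards [isOpen_ball.mem_nhds hx] with y hy
      rw [hnorm y (ball_subset_closedBall hy), one_pow]
    have h1 := (hrd.norm_sq).unique ((hasFDerivAt_const (1 : ℝ) x).congr_of_eventuallyEq hconst)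
    have hv' : fderiv ℝ r x v = r x := hv
    have h2 := DFunLike.congr_fun h1 v
    rw [smul_apply, ContinuousLinearMap.comp_apply, hv', innerSL_apply_apply,
      real_inner_self_eq_norm_sq, hnorm x (ball_subset_closedBall hx)] at h2
    norm_num at h2
  rw [setIntegral_congr_fun measurableSet_ball hzero] at hfinal
  have hpos : 0 < μ.real (ball (0 : E) 1) :=
    ENNReal.toReal_pos (measure_ball_pos μ 0 one_pos).ne' measure_ball_lt_top.ne
  simp at hfinal
  exact hpos.ne hfinal

theorem exists_fixedPoint_of_contDiff_unitBall {f : E → E} (hf : ContDiff ℝ 1 f)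
    (hmaps : ∀ x ∈ closedBall (0 : E) 1, ‖f x‖ ≤ 1) : ∃ x ∈ closedBall (0 : E) 1, f x = x := by
  by_contra! hne
  let u : E → E := fun x => x - f x
  let D : E → ℝ := fun x => ⟪x, u x⟫ ^ 2 + ‖u x‖ ^ 2 * (1 - ‖x‖ ^ 2)
  let l : E → ℝ := fun x => (-⟪x, u x⟫ + √(D x)) / ‖u x‖ ^ 2
  have hu : ContDiff ℝ 1 u := contDiff_id.sub hf
  have hu0 : ∀ x ∈ closedBall (0 : E) 1, 0 < ‖u x‖ ^ 2 := fun x hx =>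
    pow_pos (norm_pos_iff.2 (sub_ne_zero.2 (hne x hx).symm)) 2
  have hsph : ∀ x : E, ‖x‖ = 1 → 0 < ⟪x, u x⟫ := by
    intro x hx
    have hxb : x ∈ closedBall (0 : E) 1 := by simp [hx]
    have h1 := hu0 x hxb
    have h2 := hmaps x hxb
    have h3 : ‖u x‖ ^ 2 = ‖x‖ ^ 2 - 2 * ⟪x, f x⟫ + ‖f x‖ ^ 2 := norm_sub_sq_real x (f x)
    have h4 : ⟪x, u x⟫ = ‖x‖ ^ 2 - ⟪x, f x⟫ := by
      simp only [u]
      rw [inner_sub_right, real_inner_self_eq_norm_sq]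
    rw [hx] at h3 h4
    nlinarith [norm_nonneg (f x)]
  have hD : ∀ x ∈ closedBall (0 : E) 1, 0 < D x := by
    intro x hx
    rcases (mem_closedBall_zero_iff.1 hx).lt_or_eq with h | h
    · have : 0 < 1 - ‖x‖ ^ 2 := by nlinarith [norm_nonneg x]
      have := mul_pos (hu0 x hx) this
      simp only [D]
      positivity
    · have := hsph x h
      simp only [D, h]
      nlinarith
  have hDc : ContDiff ℝ 1 D := by
    have := contDiff_id.norm_sq ℝ (E := E) (n := 1)
    exact ((contDiff_id.inner ℝ hu).pow 2).add ((hu.norm_sq ℝ).mul (contDiff_const.sub this))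
  refine not_exists_contDiff_retraction_sphere (fun x => x + l x • u x) ?_ ?_ ?_
  · intro x hx
    refine contDiffAt_id.add (ContDiffAt.smul (ContDiffAt.div ?_ ?_ (hu0 x hx).ne') hu.contDiffAt)
    · exact (contDiff_id.inner ℝ hu).neg.contDiffAt.add (hDc.contDiffAt.sqrt (hD x hx).ne')
    · exact (hu.norm_sq ℝ).contDiffAt
  · intro x hx
    have hq := (hu0 x hx).ne'
    have h1 : l x * ‖u x‖ ^ 2 = -⟪x, u x⟫ + √(D x) := div_mul_cancel₀ _ hq
    have h2 : √(D x) ^ 2 = ⟪x, u x⟫ ^ 2 + ‖u x‖ ^ 2 * (1 - ‖x‖ ^ 2) := Real.sq_sqrt (hD x hx).le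
    have h3 : ‖x + l x • u x‖ ^ 2 = 1 := by
      rw [norm_add_sq_real, norm_smul, inner_smul_right, mul_pow, Real.norm_eq_abs, sq_abs]
      have h4 : √(D x) = l x * ‖u x‖ ^ 2 + ⟪x, u x⟫ := by linarith
      rw [h4] at h2
      refine mul_left_cancel₀ hq ?_
      linarith
    exact (pow_eq_one_iff_of_nonneg (norm_nonneg _) two_ne_zero).1 h3
  · intro x hx
    have hx1 := mem_sphere_zero_iff_norm.1 hx
    have : l x = 0 := by simp [l, D, hx1, Real.sqrt_sq (hsph x hx1).le]
    simp [this]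

theorem exists_fixedPoint_of_contDiff {f : E → E} {R : ℝ} (hR : 0 < R) (hf : ContDiff ℝ 1 f)
    (hmaps : ∀ x ∈ closedBall (0 : E) R, ‖f x‖ ≤ R) : ∃ x ∈ closedBall (0 : E) R, f x = x := by
  have hmem : ∀ x ∈ closedBall (0 : E) 1, R • x ∈ closedBall (0 : E) R := by
    intro x hx
    rw [mem_closedBall_zero_iff] at hx ⊢
    rw [norm_smul, Real.norm_of_nonneg hR.le]
    exact mul_le_of_le_one_right hR.le hx
  obtain ⟨x, hx, hfx⟩ := exists_fixedPoint_of_contDiff_unitBall (f := fun x => R⁻¹ • f (R • x))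
    (by fun_prop) (fun x hx => by
      rw [norm_smul, norm_inv, Real.norm_of_nonneg hR.le, inv_mul_le_one₀ hR]
      exact hmaps _ (hmem x hx))
  exact ⟨R • x, hmem x hx, (inv_smul_eq_iff₀ hR.ne').1 hfx⟩

theorem exists_fixedPoint_of_continuous_bounded {f : E → E} (hf : Continuous f) {R : ℝ}
    (hb : ∀ x, ‖f x‖ ≤ R) : ∃ x, f x = x := by
  have hR : 0 ≤ R := (norm_nonneg _).trans (hb 0)
  obtain ⟨x, hx, hmin⟩ := (isCompact_closedBall (0 : E) (R + 1)).exists_isMinOn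
    (nonempty_closedBall.2 (by positivity)) (f := fun x => dist (f x) x)
    (by fun_prop)
  refine ⟨x, ?_⟩
  by_contra hne
  have hpos : 0 < min 1 (dist (f x) x) := lt_min one_pos (dist_pos.2 hne)
  obtain ⟨h, hh, happ, -⟩ := hf.exists_contDiff_approx 1 continuous_const (fun _ => hpos)
  obtain ⟨y, hy, hfy⟩ := exists_fixedPoint_of_contDiff (R := R + 1) (by positivity) hh (by
    intro y _
    have h1 := (happ y).trans_le (min_le_left _ _)
    rw [dist_eq_norm] at h1
    calc ‖h y‖ = ‖(h y - f y) + f y‖ := by rw [sub_add_cancel]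
      _ ≤ 1 + R := (norm_add_le _ _).trans (add_le_add h1.le (hb y))
      _ = R + 1 := add_comm _ _)
  have h1 := (happ y).trans_le (min_le_right _ _)
  rw [hfy, dist_comm] at h1
  exact absurd (hmin hy) (not_le.2 h1)

theorem exists_variational_inequality_solution {K : Set E} (hK : IsCompact K) (hc : Convex ℝ K)
    (hne : K.Nonempty) {F : E → E} (hF : Continuous F) :
    ∃ x ∈ K, ∀ y ∈ K, ⟪F x, y - x⟫ ≤ 0 := by
  choose p hpK hp using exists_norm_eq_iInf_of_complete_convex hne hK.isComplete hc
  have hvi : ∀ u, ∀ w ∈ K, ⟪u - p u, w - p u⟫ ≤ 0 := fun u =>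
    (norm_eq_iInf_iff_real_inner_le_zero hc (hpK u)).1 (hp u)
  have hlip : LipschitzWith 1 p := by
    refine LipschitzWith.of_dist_le_mul fun u v => ?_
    rw [NNReal.coe_one, one_mul, dist_eq_norm, dist_eq_norm]
    have h1 := hvi u (p v) (hpK v)
    have h2 := hvi v (p u) (hpK u)
    have h3 : ‖p u - p v‖ ^ 2 ≤ ⟪u - v, p u - p v⟫ := by
      rw [← real_inner_self_eq_norm_sq]
      simp only [inner_sub_left, inner_sub_right] at *
      linarith
    have h4 := h3.trans (real_inner_le_norm _ _)
    rw [sq] at h4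
    by_cases h0 : 0 < ‖p u - p v‖
    · exact le_of_mul_le_mul_right h4 h0
    · exact (not_lt.1 h0).trans (norm_nonneg _)
  obtain ⟨R, hR⟩ := hK.isBounded.exists_norm_le
  obtain ⟨x, hx⟩ := exists_fixedPoint_of_continuous_bounded (f := fun x => p (x + F x))
    (hlip.continuous.comp (continuous_id.add hF)) (fun x => hR _ (hpK _))
  refine ⟨x, hx ▸ hpK _, fun y hy => ?_⟩
  have := hvi (x + F x) y hy
  have hx' : p (x + F x) = x := hx
  rwa [hx', add_sub_cancel_left] at this

end Brouwer

section Nash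

variable {ι : Type*} [Fintype ι] [DecidableEq ι] {B : ι → Type*} [∀ j, Fintype (B j)]

/-- Expected payoff of the payoff function `v` under the mixed strategy profile `σ`. -/
def mixedPayoff (σ : (j : ι) → B j → ℝ) (v : ((j : ι) → B j) → ℝ) : ℝ :=
  ∑ a, (∏ j, σ j (a j)) * v a

open Classical in
/-- Payoff of the pure strategy `b` of player `k` against the mixed strategies of the others. -/
noncomputable def purePayoff (σ : (j : ι) → B j → ℝ) (v : ((j : ι) → B j) → ℝ) (k : ι) (b : B k) :
    ℝ :=
  ∑ a, if a k = b then (∏ j ∈ univ.erase k, σ j (a j)) * v a else 0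

theorem mixedPayoff_update (σ : (j : ι) → B j → ℝ) (v : ((j : ι) → B j) → ℝ) (k : ι)
    (τ : B k → ℝ) :
    mixedPayoff (Function.update σ k τ) v = ∑ b, τ b * purePayoff σ v k b := by
  classical
  simp only [mixedPayoff, purePayoff, mul_sum]
  rw [sum_comm]
  refine sum_congr rfl fun a _ => ?_
  have h : ∏ j ∈ univ.erase k, Function.update σ k τ j (a j) =
      ∏ j ∈ univ.erase k, σ j (a j) :=
    prod_congr rfl fun j hj => by rw [Function.update_of_ne (ne_of_mem_erase hj)]
  rw [← mul_prod_erase univ _ (mem_univ k), h, Function.update_self]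
  simp [mul_assoc]

theorem mixedPayoff_mono {σ : (j : ι) → B j → ℝ} (hσ : ∀ j b, 0 ≤ σ j b)
    {v w : ((j : ι) → B j) → ℝ} (h : ∀ a, v a ≤ w a) : mixedPayoff σ v ≤ mixedPayoff σ w :=
  sum_le_sum fun a _ => mul_le_mul_of_nonneg_left (h a) (prod_nonneg fun j _ => hσ j (a j))

/-- **Nash's theorem**: every finite game has a mixed Nash equilibrium. -/
theorem exists_mixed_nash [∀ j, Nonempty (B j)] (v : ι → ((j : ι) → B j) → ℝ) :
    ∃ σ : (j : ι) → B j → ℝ, (∀ j, σ j ∈ stdSimplex ℝ (B j)) ∧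
      ∀ k, ∀ τ ∈ stdSimplex ℝ (B k),
        mixedPayoff (Function.update σ k τ) (v k) ≤ mixedPayoff σ (v k) := by
  classical
  let profile : EuclideanSpace ℝ (Σ j, B j) → (j : ι) → B j → ℝ := fun x j b => x ⟨j, b⟩
  let vec : ((j : ι) → B j → ℝ) → EuclideanSpace ℝ (Σ j, B j) :=
    fun σ => WithLp.toLp 2 fun p => σ p.1 p.2
  let K : Set (EuclideanSpace ℝ (Σ j, B j)) :=
    vec '' Set.univ.pi fun j => stdSimplex ℝ (B j)
  have hvec : Continuous vec :=
    (PiLp.continuous_toLp 2 fun _ : Σ j, B j => ℝ).comp (by fun_prop)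
  have hK : IsCompact K := (isCompact_univ_pi fun j => isCompact_stdSimplex ℝ (B j)).image hvec
  have hc : Convex ℝ K := (convex_pi fun j _ => convex_stdSimplex ℝ (B j)).is_linear_image
    ⟨fun _ _ => rfl, fun _ _ => rfl⟩
  have hne : K.Nonempty := by
    refine Set.Nonempty.image _ (Set.univ_pi_nonempty_iff.2 fun j => ?_)
    exact ⟨_, single_mem_stdSimplex ℝ (Classical.arbitrary (B j))⟩
  let F : EuclideanSpace ℝ (Σ j, B j) → EuclideanSpace ℝ (Σ j, B j) :=
    fun x => vec fun k b => purePayoff (profile x) (v k) k b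
  have hF : Continuous F := by
    suffices hpay : ∀ k b, Continuous fun x => purePayoff (profile x) (v k) k b from
      hvec.comp (continuous_pi fun k => continuous_pi (hpay k))
    intro k b
    unfold purePayoff
    refine continuous_finsetSum _ fun a _ => ?_
    split_ifs
    · simp only [profile]
      fun_prop
    · exact continuous_const
  obtain ⟨_, ⟨σ, hσ, rfl⟩, hvi⟩ := exists_variational_inequality_solution hK hc hne hF
  refine ⟨σ, fun j => hσ j trivial, fun k τ hτ => ?_⟩
  have h := hvi (vec (Function.update σ k τ)) ⟨_, fun j _ => by
    by_cases hj : j = k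
    · subst hj; simpa using hτ
    · simpa [hj] using hσ j trivial, rfl⟩
  have hinner : inner ℝ (F (vec σ)) (vec (Function.update σ k τ) - vec σ) =
      ∑ j, ∑ b, (Function.update σ k τ j b - σ j b) * purePayoff σ (v j) j b := by
    rw [PiLp.inner_apply, Fintype.sum_sigma]
    rfl
  rw [hinner, sum_eq_single k (fun j _ hj => by simp [hj]) (by simp)] at h
  have hσk := mixedPayoff_update σ (v k) k (σ k)
  rw [Function.update_eq_self] at hσk
  rw [mixedPayoff_update, hσk]
  simpa [sub_mul, sum_sub_distrib] using h

end Nash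

section BackwardInduction

/-- Payoffs of the one-step game at step `h` and state `s`, scalarized by summing the objectives,
when `W` gives the scalarized continuation values. -/
def stagePayoff (G : MOMG N M H S A) (W : S → Fin N → ℝ) (h : Fin H) (s : S) (k : Fin N)
    (a : (j : Fin N) → A j) : ℝ :=
  ∑ i, G.r k h s a i + ∑ s', G.P h s a s' * W s' k

theorem sum_Vvec_succ (G : MOMG N M H S A) (k : Fin N)
    (π : (j : Fin N) → Fin H → S → A j → ℝ) (t : ℕ) (ht : H - (t + 1) < H) (s : S) :
    ∑ i, Vvec G k π (t + 1) s i = mixedPayoff (fun j => π j ⟨H - (t + 1), ht⟩ s)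
      (stagePayoff G (fun s' _ => ∑ i, Vvec G k π t s' i) ⟨H - (t + 1), ht⟩ s k) := by
  simp only [Vvec, dif_pos ht, mixedPayoff, stagePayoff]
  rw [sum_comm]
  refine sum_congr rfl fun a _ => ?_
  rw [← mul_sum, sum_add_distrib, sum_comm (s := (univ : Finset (Fin M)))]
  simp_rw [mul_sum]

theorem stagePayoff_mono (G : MOMG N M H S A) {W W' : S → Fin N → ℝ} {k : Fin N}
    (hW : ∀ s, W s k ≤ W' s k) (h : Fin H) (s : S) (a : (j : Fin N) → A j) :
    stagePayoff G W h s k a ≤ stagePayoff G W' h s k a :=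
  add_le_add_right (sum_le_sum fun s' _ =>
    mul_le_mul_of_nonneg_left (hW s') (G.P_nonneg h s a s')) _

variable [∀ j, Nonempty (A j)]

/-- A mixed Nash equilibrium of the finite game with payoffs `v`. -/
noncomputable def nashProfile (v : Fin N → ((j : Fin N) → A j) → ℝ) : (j : Fin N) → A j → ℝ :=
  (exists_mixed_nash v).choose

theorem nashProfile_mem (v : Fin N → ((j : Fin N) → A j) → ℝ) (j : Fin N) :
    nashProfile v j ∈ stdSimplex ℝ (A j) :=
  (exists_mixed_nash v).choose_spec.1 j

theorem mixedPayoff_update_nashProfile_le (v : Fin N → ((j : Fin N) → A j) → ℝ) (k : Fin N)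
    {τ : A k → ℝ} (hτ : τ ∈ stdSimplex ℝ (A k)) :
    mixedPayoff (Function.update (nashProfile v) k τ) (v k) ≤
      mixedPayoff (nashProfile v) (v k) :=
  (exists_mixed_nash v).choose_spec.2 k τ hτ

/-- Scalarized equilibrium values with `t` remaining steps. -/
noncomputable def equilibriumValue (G : MOMG N M H S A) : ℕ → S → Fin N → ℝ
  | 0, _, _ => 0
  | t + 1, s, k =>
    if ht : H - (t + 1) < H then
      mixedPayoff (nashProfile (stagePayoff G (equilibriumValue G t) ⟨H - (t + 1), ht⟩ s))
        (stagePayoff G (equilibriumValue G t) ⟨H - (t + 1), ht⟩ s k)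
    else 0

/-- The policy playing a Nash equilibrium of the one-step game at every step and state. -/
noncomputable def equilibriumPolicy (G : MOMG N M H S A) (j : Fin N) (h : Fin H) (s : S) :
    A j → ℝ :=
  nashProfile (stagePayoff G (equilibriumValue G (H - (h + 1))) h s) j

theorem equilibriumPolicy_isProductPolicy (G : MOMG N M H S A) :
    IsProductPolicy (equilibriumPolicy G) :=
  fun j _ _ => nashProfile_mem _ j

theorem equilibriumPolicy_eq_nashProfile (G : MOMG N M H S A) {t : ℕ} (ht : t + 1 ≤ H)
    (hlt : H - (t + 1) < H) (s : S) :
    (fun j => equilibriumPolicy G j ⟨H - (t + 1), hlt⟩ s) =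
      nashProfile (stagePayoff G (equilibriumValue G t) ⟨H - (t + 1), hlt⟩ s) := by
  have h : H - (H - (t + 1) + 1) = t := by omega
  funext j
  simp only [equilibriumPolicy, h]

theorem sum_Vvec_equilibriumPolicy (G : MOMG N M H S A) (k : Fin N) (t : ℕ) (ht : t ≤ H) (s : S) :
    ∑ i, Vvec G k (equilibriumPolicy G) t s i = equilibriumValue G t s k := by
  induction t generalizing s with
  | zero => simp [Vvec, equilibriumValue]
  | succ t ih =>
    have hlt : H - (t + 1) < H := by omega
    rw [sum_Vvec_succ G k _ t hlt s, equilibriumPolicy_eq_nashProfile G ht hlt, equilibriumValue,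
      dif_pos hlt]
    congr 1
    funext a
    simp only [stagePayoff, ih (Nat.le_of_succ_le ht)]

theorem sum_Vvec_update_equilibriumPolicy_le (G : MOMG N M H S A) (k : Fin N)
    {ρ : Fin H → S → A k → ℝ} (hρ : IsPolicy ρ) (t : ℕ) (ht : t ≤ H) (s : S) :
    ∑ i, Vvec G k (Function.update (equilibriumPolicy G) k ρ) t s i ≤
      equilibriumValue G t s k := by
  induction t generalizing s with
  | zero => simp [Vvec, equilibriumValue]
  | succ t ih =>
    have hlt : H - (t + 1) < H := by omega
    have hprofile : (fun j => Function.update (equilibriumPolicy G) k ρ j ⟨H - (t + 1), hlt⟩ s) =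
        Function.update
          (nashProfile (stagePayoff G (equilibriumValue G t) ⟨H - (t + 1), hlt⟩ s)) k
          (ρ ⟨H - (t + 1), hlt⟩ s) := by
      rw [← equilibriumPolicy_eq_nashProfile G ht hlt]
      funext j
      by_cases hj : j = k
      · subst hj; simp
      · simp [hj]
    rw [sum_Vvec_succ G k _ t hlt s, hprofile, equilibriumValue, dif_pos hlt]
    refine (mixedPayoff_mono (fun j b => ?_) (stagePayoff_mono G
      (fun s' => ih (Nat.le_of_succ_le ht) s') _ s)).trans
      (mixedPayoff_update_nashProfile_le _ k (hρ _ s))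
    by_cases hj : j = k
    · subst hj; simpa using (hρ ⟨H - (t + 1), hlt⟩ s).1 b
    · simpa [hj] using (nashProfile_mem _ j).1 b

end BackwardInduction

/-- **Existence of a stochastic Pareto-Nash Equilibrium.**
Every finite multi-objective Markov game admits a product policy
`π* = (π*_1, …, π*_N)` such that for every agent `k` there is no policy `π_k`
for which `V_{k,1}^{(π_k, π*_{-k})}(s_1)` Pareto dominates `V_{k,1}^{π*}(s_1)`. -/
theorem exists_PNE {N M H : ℕ} (hN : 1 ≤ N) (hH : 1 ≤ H)
    (S : Type) (A : Fin N → Type) [Fintype S] [Nonempty S]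
    [∀ j, Fintype (A j)] [∀ j, Nonempty (A j)]
    (G : MOMG N M H S A) (s1 : S) :
    ∃ π : (j : Fin N) → Fin H → S → A j → ℝ,
      IsProductPolicy π ∧ IsPNE G s1 π := by
  refine ⟨equilibriumPolicy G, equilibriumPolicy_isProductPolicy G, fun k ρ hρ hdom => ?_⟩
  have hle := sum_Vvec_update_equilibriumPolicy_le G k hρ H le_rfl s1
  rw [← sum_Vvec_equilibriumPolicy G k H le_rfl s1] at hle
  obtain ⟨i, hi⟩ := hdom.2
  exact absurd hle (not_le.2 (sum_lt_sum (fun i _ => hdom.1 i) ⟨i, mem_univ i, hi⟩))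
end

section
/- Let G be a finite MOMG and let u_k : ℝ^M → ℝ, k = 1,…,N, be utility functions that are continuous and quasi-concave. Then a Scalarized Expected Return Nash Equilibrium (SER-NE) exists: there is a product policy π* = (π*_1,…,π*_N) such that for every agent k and every policy π_k, u_k( V_{k,1}^{(π_k, π*_{-k})}(s_1) ) ≤ u_k( V_{k,1}^{(π*_k, π*_{-k})}(s_1) ). -/
open Finset

variable {N M H : ℕ} {S : Type} {A : Fin N → Type} [Fintype S] [∀ j, Fintype (A j)]

/-- A finite set `R` is dominant for the family of rankings `f` if every element is ranked, by
some `f i`, no higher than all the elements of `R`. -/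
def Dominant {I Y : Type} (f : I → Y → ℕ) (R : Finset Y) : Prop :=
  ∀ z, ∃ i, ∀ y ∈ R, f i z ≤ f i y

theorem Dominant.mono {I Y : Type} {f : I → Y → ℕ} {R R' : Finset Y} (h : Dominant f R)
    (hR : R' ⊆ R) : Dominant f R' := fun z => by
  obtain ⟨i, hi⟩ := h z
  exact ⟨i, fun y hy => hi y (hR hy)⟩

/-- A dominant set with one element less than the number of rankings extends to a dominant set
by one more element in exactly two ways, provided that for each `i` some element outside is
ranked strictly above the `f l`-minimum of the set for all `l ≠ i`. -/
theorem Dominant.card_extensions {I Y : Type} [Fintype I] [DecidableEq I] [Fintype Y]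
    [DecidableEq Y] {f : I → Y → ℕ} (hf : ∀ i, Function.Injective (f i)) {τ : Finset Y}
    (hτ : Dominant f τ) (hcard : #τ + 1 = Fintype.card I) (hne : τ.Nonempty)
    (hM : ∀ i, ∃ x, ∀ l, l ≠ i → ∃ y ∈ τ, f l y < f l x)
    [DecidablePred fun x => x ∉ τ ∧ Dominant f (insert x τ)] :
    #{x | x ∉ τ ∧ Dominant f (insert x τ)} = 2 := by
  have hmin : ∀ i, ∃ y ∈ τ, ∀ z ∈ τ, f i y ≤ f i z := fun i =>
    Finset.exists_min_image τ (f i) hne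
  choose m hmτ hm using hmin
  have hsurj : ∀ y ∈ τ, ∃ i, m i = y := by
    intro y hy
    obtain ⟨i, hi⟩ := hτ y
    exact ⟨i, hf i (le_antisymm (hm i y hy) (hi _ (hmτ i)))⟩
  obtain ⟨i, -, j, -, hij, hmij⟩ : ∃ i ∈ (univ : Finset I), ∃ j ∈ (univ : Finset I),
      i ≠ j ∧ m i = m j :=
    Finset.exists_ne_map_eq_of_card_lt_of_maps_to (t := τ)
      (by rw [Finset.card_univ]; omega) (fun i _ => hmτ i)
  have inj : ∀ i j, i ≠ j → m i = m j → ∀ k l, k ≠ i → l ≠ i → m k = m l → k = l := by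
    intro i j hij hmij k l hk hl hkl
    have himg : (univ.erase i).image m = τ := by
      ext y
      simp only [mem_image, mem_erase, mem_univ, and_true]
      constructor
      · rintro ⟨a, -, rfl⟩
        exact hmτ a
      · intro hy
        obtain ⟨a, rfl⟩ := hsurj y hy
        by_cases ha : a = i
        · exact ⟨j, hij.symm, by rw [ha, hmij]⟩
        · exact ⟨a, ha, rfl⟩
    have hc : #((univ.erase i).image m) = #(univ.erase i) := by
      rw [himg, Finset.card_erase_of_mem (mem_univ i), Finset.card_univ]
      omega
    exact Finset.card_image_iff.mp hc (by simpa using hk) (by simpa using hl) hkl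
  -- the extensions in which the new element becomes the `i`-minimum
  have key : ∀ i j, i ≠ j → m i = m j → ∃ x, (x ∉ τ ∧ Dominant f (insert x τ)) ∧
      f i x < f i (m i) ∧ (∀ l, l ≠ i → f l (m l) < f l x) ∧
      ∀ x', (x' ∉ τ ∧ Dominant f (insert x' τ)) → f i x' < f i (m i) → x' = x := by
    intro i j hij hmij
    have hne' : ({x | ∀ l, l ≠ i → f l (m l) < f l x} : Finset Y).Nonempty := by
      obtain ⟨x, hx⟩ := hM i
      refine ⟨x, mem_filter.mpr ⟨mem_univ _, fun l hl => ?_⟩⟩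
      obtain ⟨y, hy, hyx⟩ := hx l hl
      exact (hm l y hy).trans_lt hyx
    obtain ⟨x, hx, hmax⟩ := Finset.exists_max_image _ (f i) hne'
    simp only [mem_filter, mem_univ, true_and] at hx hmax
    have hxi : f i x < f i (m i) := by
      obtain ⟨l, hl⟩ := hτ x
      have hli : l = i := by
        by_contra hli
        exact absurd (hl _ (hmτ l)) (not_le.mpr (hx l hli))
      subst hli
      refine lt_of_le_of_ne (hl _ (hmτ l)) fun h => ?_
      have := hx j hij.symm
      rw [hf l h, hmij] at this
      exact lt_irrefl _ this
    refine ⟨x, ⟨fun h => absurd (hm i x h) (not_le.mpr hxi), fun z => ?_⟩, hxi, hx, ?_⟩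
    · by_cases hz : ∀ l, l ≠ i → f l (m l) < f l z
      · refine ⟨i, fun y hy => ?_⟩
        rcases mem_insert.mp hy with rfl | hy
        · exact hmax z hz
        · exact (hmax z hz).trans (hxi.le.trans (hm i y hy))
      · push Not at hz
        obtain ⟨l, hl, hzl⟩ := hz
        refine ⟨l, fun y hy => ?_⟩
        rcases mem_insert.mp hy with rfl | hy
        · exact hzl.trans (hx l hl).le
        · exact hzl.trans (hm l y hy)
    · rintro x' ⟨hx'τ, hdom⟩ hlt
      have hx' : ∀ l, l ≠ i → f l (m l) < f l x' := by
        intro l hl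
        obtain ⟨l', hl'⟩ := hdom (m l)
        have h1 : m l' = m l := hf l' (le_antisymm (hm l' _ (hmτ l))
          (hl' _ (mem_insert_of_mem (hmτ l'))))
        have h2 : f l' (m l) ≤ f l' x' := hl' _ (mem_insert_self _ _)
        have h3 : l' ≠ i := by
          rintro rfl
          rw [← h1] at h2
          exact absurd h2 (not_le.mpr hlt)
        have h4 := inj i j hij hmij l' l h3 hl h1
        subst h4
        refine lt_of_le_of_ne h2 fun h => hx'τ ?_
        rw [← hf _ h]
        exact hmτ _
      refine hf i (le_antisymm (hmax x' hx') ?_)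
      obtain ⟨l, hl⟩ := hdom x
      have hli : l = i := by
        by_contra hli
        exact absurd (hl _ (mem_insert_of_mem (hmτ l))) (not_le.mpr (hx l hli))
      subst hli
      exact hl _ (mem_insert_self _ _)
  obtain ⟨x, hx, hxi, hxl, hxu⟩ := key i j hij hmij
  obtain ⟨y, hy, hyj, hyl, hyu⟩ := key j i hij.symm hmij.symm
  have hxy : x ≠ y := by
    rintro rfl
    exact absurd (hyl i hij) (not_lt.mpr hxi.le)
  rw [Finset.card_eq_two]
  refine ⟨x, y, hxy, ?_⟩
  ext z
  simp only [mem_filter, mem_univ, true_and, mem_insert, mem_singleton]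
  constructor
  · intro hz
    obtain ⟨k, hk⟩ := hz.2 z
    have hkz : f k z < f k (m k) := by
      refine lt_of_le_of_ne (hk _ (mem_insert_of_mem (hmτ k))) fun h => hz.1 ?_
      rw [hf _ h]
      exact hmτ k
    by_cases hki : k = i
    · subst hki
      exact Or.inl (hxu z hz hkz)
    by_cases hkj : k = j
    · subst hkj
      exact Or.inr (hyu z hz hkz)
    exfalso
    obtain ⟨l, hl⟩ := hz.2 (m k)
    have h1 : m l = m k := hf l (le_antisymm (hm l _ (hmτ k))
      (hl _ (mem_insert_of_mem (hmτ l))))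
    have hlk : l ≠ k := by
      rintro rfl
      exact absurd (hl _ (mem_insert_self _ _)) (not_le.mpr hkz)
    by_cases hli : l = i
    · subst hli
      exact hkj (inj l j hij hmij j k hij.symm hki (by rw [← hmij, h1])).symm
    · exact hlk (inj i j hij hmij l k hli hki h1)
  · rintro (rfl | rfl)
    · exact hx
    · exact hy

/-- Removing one element from a set with as many elements as there are colors, and which does
not carry all colors, yields a set carrying all colors but `i₀` in zero or two ways. -/
theorem even_card_erase_image_eq {I Y : Type} [Fintype I] [DecidableEq I] [DecidableEq Y]
    (c : Y → I) (i₀ : I) {R : Finset Y} (hcard : #R = Fintype.card I) (hR : R.image c ≠ univ) :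
    Even #{x ∈ R | (R.erase x).image c = univ.erase i₀} := by
  rcases Finset.eq_empty_or_nonempty {x ∈ R | (R.erase x).image c = univ.erase i₀} with h | h
  · simp [h]
  obtain ⟨x, hx⟩ := h
  obtain ⟨hxR, hx⟩ := mem_filter.mp hx
  have hinj : Set.InjOn c (R.erase x) := by
    apply Finset.card_image_iff.mp
    rw [hx, Finset.card_erase_of_mem (mem_univ _), Finset.card_erase_of_mem hxR, hcard,
      Finset.card_univ]
  have hcx : c x ≠ i₀ := by
    intro h
    apply hR
    rw [← Finset.insert_erase hxR, Finset.image_insert, hx, h,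
      Finset.insert_erase (mem_univ _)]
  have : c x ∈ (R.erase x).image c := by rw [hx]; simpa using hcx
  obtain ⟨y, hy, hyx⟩ := mem_image.mp this
  have hyx' := (mem_erase.mp hy).1
  have hyR := (mem_erase.mp hy).2
  have himg : R.image c = univ.erase i₀ := by
    rw [← Finset.insert_erase hxR, Finset.image_insert, hx]
    exact Finset.insert_eq_of_mem (by simpa using hcx)
  have : ({x ∈ R | (R.erase x).image c = univ.erase i₀} : Finset Y) = {x, y} := by
    ext z
    simp only [mem_filter, mem_insert, mem_singleton]
    constructor
    · rintro ⟨hzR, hz⟩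
      by_contra hcon
      push Not at hcon
      have : c z ∈ (R.erase z).image c := by
        rw [hz, ← himg]
        exact mem_image_of_mem _ hzR
      obtain ⟨w, hw, hwz⟩ := mem_image.mp this
      obtain ⟨hwz', hwR⟩ := mem_erase.mp hw
      by_cases hwx : w = x
      · subst hwx
        exact hcon.2 (hinj (by simp [hcon.1, hzR]) (by simp [hyx', hyR]) (by rw [← hwz, hyx]))
      · exact hwz' (hinj (by simp [hwx, hwR]) (by simp [hcon.1, hzR]) hwz)
    · rintro (rfl | rfl)
      · exact ⟨hxR, hx⟩
      · refine ⟨hyR, ?_⟩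
        rw [← himg]
        apply Finset.Subset.antisymm (Finset.image_subset_image (Finset.erase_subset _ _))
        intro i hi
        obtain ⟨w, hw, rfl⟩ := mem_image.mp hi
        by_cases hwz : w = z
        · subst hwz
          rw [hyx]
          exact mem_image_of_mem _ (mem_erase.mpr ⟨hyx'.symm, hxR⟩)
        · exact mem_image_of_mem _ (mem_erase.mpr ⟨hwz, hw⟩)
  rw [this, Finset.card_pair hyx'.symm]
  exact even_two

/-- **Scarf's combinatorial lemma**: for finitely many rankings of a finite nonempty set and any
coloring by the set of rankings, some set dominant with respect to a set `C` of rankings carries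
all the colors in `C`. -/
theorem exists_dominant_colorful {I X : Type} [Fintype I] [DecidableEq I] [Nonempty I]
    [Fintype X] [DecidableEq X] [Nonempty X] (ρ : I → X → ℕ)
    (hρ : ∀ i, Function.Injective (ρ i)) (c : X → I) :
    ∃ (σ : Finset X) (C : Finset I), (∀ x, ∃ i ∈ C, ∀ y ∈ σ, ρ i x ≤ ρ i y) ∧
      ∀ i ∈ C, ∃ y ∈ σ, c y = i := by
  classical
  obtain ⟨B, hB⟩ : ∃ B, ∀ i x, ρ i x < B := by
    refine ⟨∑ p : I × X, ρ p.1 p.2 + 1, fun i x => Nat.lt_succ_of_le ?_⟩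
    exact Finset.single_le_sum (f := fun p : I × X => ρ p.1 p.2) (fun _ _ => Nat.zero_le _)
      (mem_univ (i, x))
  let e := Fintype.equivFin I
  let f : I → X ⊕ I → ℕ := fun i =>
    Sum.elim (fun x => ρ i x + 1) (fun j => if j = i then 0 else B + 1 + e j)
  let d : X ⊕ I → I := Sum.elim c id
  have f_inl : ∀ i x, f i (Sum.inl x) = ρ i x + 1 := fun _ _ => rfl
  have f_inr : ∀ i j, f i (Sum.inr j) = if j = i then 0 else B + 1 + e j := fun _ _ => rfl
  have f_lt : ∀ i j x, j ≠ i → f i (Sum.inl x) < f i (Sum.inr j) := by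
    intro i j x hj
    rw [f_inl, f_inr, if_neg hj]
    have := hB i x
    omega
  have hf : ∀ i, Function.Injective (f i) := by
    rintro i (x | j) (y | k) h
    · rw [f_inl, f_inl] at h
      rw [hρ i (Nat.succ_injective h)]
    · by_cases hk : k = i
      · rw [f_inl, f_inr, if_pos hk] at h
        omega
      · exact absurd h (f_lt i k x hk).ne
    · by_cases hk : j = i
      · rw [f_inl, f_inr, if_pos hk] at h
        omega
      · exact absurd h (f_lt i j y hk).ne'
    · rw [f_inr, f_inr] at h
      split_ifs at h with h1 h2 h2
      · rw [h1, h2]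
      · omega
      · omega
      · have : j = k := e.injective (Fin.ext (by omega))
        rw [this]
  obtain ⟨R, hR, hRc⟩ : ∃ R : Finset (X ⊕ I), Dominant f R ∧ R.image d = univ := by
    by_contra! hcon
    let i₀ := Classical.arbitrary I
    let rooms : Finset (Finset (X ⊕ I)) := {R | Dominant f R ∧ #R = Fintype.card I}
    let doors : Finset (Finset (X ⊕ I)) :=
      {τ | Dominant f τ ∧ #τ + 1 = Fintype.card I ∧ τ.image d = univ.erase i₀}
    let out : Finset (X ⊕ I) := (univ.erase i₀).image Sum.inr
    have hout_inl : ∀ x, Sum.inl x ∉ out := by simp [out]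
    have hout_inr : ∀ i, Sum.inr i ∈ out ↔ i ≠ i₀ := by simp [out]
    have hcount := Finset.sum_card_bipartiteAbove_eq_sum_card_bipartiteBelow
      (s := doors) (t := rooms) (fun τ R => τ ⊆ R)
    have hrooms : Even (∑ R ∈ rooms, #(doors.bipartiteBelow (fun τ R => τ ⊆ R) R)) := by
      refine Finset.even_sum _ fun R hR => ?_
      obtain ⟨hRd, hRcard⟩ := (mem_filter.mp hR).2
      have := even_card_erase_image_eq d i₀ hRcard (hcon R hRd)
      suffices #{x ∈ R | (R.erase x).image d = univ.erase i₀} =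
          #(doors.bipartiteBelow (fun τ R => τ ⊆ R) R) by rwa [← this]
      apply Finset.card_bij (fun x _ => R.erase x)
      · intro x hx
        obtain ⟨hxR, hx⟩ := mem_filter.mp hx
        simp only [Finset.bipartiteBelow, doors, mem_filter, mem_univ, true_and]
        exact ⟨⟨hRd.mono (Finset.erase_subset _ _),
          by rw [Finset.card_erase_add_one hxR, hRcard], hx⟩, Finset.erase_subset _ _⟩
      · intro x hx y hy hxy
        exact Finset.erase_injOn R (mem_filter.mp hx).1 (mem_filter.mp hy).1 hxy
      · intro τ hτ
        simp only [Finset.bipartiteBelow, doors, mem_filter, mem_univ, true_and] at hτ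
        obtain ⟨⟨-, hc, him⟩, hsub⟩ := hτ
        obtain ⟨x, hx, rfl⟩ : ∃ x ∉ τ, insert x τ = R := by
          have : #(R \ τ) = 1 := by
            rw [Finset.card_sdiff_of_subset hsub]
            omega
          obtain ⟨x, hx⟩ := Finset.card_eq_one.mp this
          have hx' : x ∈ R \ τ := by simp [hx]
          refine ⟨x, (mem_sdiff.mp hx').2, ?_⟩
          rw [← Finset.sdiff_union_of_subset hsub, hx]
          rfl
        exact ⟨x, by simp [Finset.erase_insert hx, him], Finset.erase_insert hx⟩
    have hext : ∀ τ ∈ doors, #(rooms.bipartiteAbove (fun τ R => τ ⊆ R) τ) =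
        #{x | x ∉ τ ∧ Dominant f (insert x τ)} := by
      intro τ hτ
      obtain ⟨hτd, hτc, hτi⟩ := (mem_filter.mp hτ).2
      symm
      apply Finset.card_bij (fun x _ => insert x τ)
      · intro x hx
        obtain ⟨hxτ, hx⟩ := (mem_filter.mp hx).2
        simp only [Finset.bipartiteAbove, rooms, mem_filter, mem_univ, true_and]
        exact ⟨⟨hx, by rw [Finset.card_insert_of_notMem hxτ, hτc]⟩, Finset.subset_insert _ _⟩
      · intro x hx y hy hxy
        exact (Finset.insert_inj (mem_filter.mp hx).2.1).mp hxy
      · intro R hR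
        simp only [Finset.bipartiteAbove, rooms, mem_filter, mem_univ, true_and] at hR
        obtain ⟨⟨hRd, hRc⟩, hsub⟩ := hR
        have : #(R \ τ) = 1 := by
          rw [Finset.card_sdiff_of_subset hsub]
          omega
        obtain ⟨x, hx⟩ := Finset.card_eq_one.mp this
        have hx' : x ∈ R \ τ := by simp [hx]
        have hins : insert x τ = R := by
          rw [← Finset.sdiff_union_of_subset hsub, hx]
          rfl
        refine ⟨x, ?_, hins⟩
        simp only [mem_filter, mem_univ, true_and]
        exact ⟨(mem_sdiff.mp hx').2, hins ▸ hRd⟩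
    have hinr : ∀ j, ∀ R : Finset (X ⊕ I), (∀ y ∈ R, f j (Sum.inr j) ≤ f j y) := by
      intro j R y _
      rw [f_inr, if_pos rfl]
      exact Nat.zero_le _
    have hout_mem : out ∈ doors := by
      simp only [doors, mem_filter, mem_univ, true_and]
      refine ⟨?_, ?_, ?_⟩
      · rintro (x | j)
        · refine ⟨i₀, fun y hy => ?_⟩
          obtain ⟨j, hj, rfl⟩ := mem_image.mp hy
          exact (f_lt _ _ _ (mem_erase.mp hj).1).le
        · exact ⟨j, hinr j _⟩
      · rw [Finset.card_image_of_injective _ Sum.inr_injective,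
          Finset.card_erase_add_one (mem_univ _), Finset.card_univ]
      · rw [Finset.image_image]
        exact Finset.image_id
    have hout_one : #{x | x ∉ out ∧ Dominant f (insert x out)} = 1 := by
      obtain ⟨x, -, hx⟩ := Finset.exists_max_image (univ : Finset X) (ρ i₀) univ_nonempty
      rw [Finset.card_eq_one]
      have hdom : ∀ R, out ⊆ R → ∀ z, ∀ i, (∀ y ∈ R, f i (Sum.inl z) ≤ f i y) → i = i₀ := by
        intro R hR z i hi
        by_contra hne
        have := hi _ (hR ((hout_inr i).mpr hne))
        rw [f_inr, if_pos rfl, f_inl] at this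
        omega
      refine ⟨Sum.inl x, ?_⟩
      ext y
      simp only [mem_filter, mem_univ, true_and, mem_singleton]
      constructor
      · rintro ⟨hy, hyd⟩
        obtain ⟨i, hi⟩ := hyd (Sum.inl x)
        have hii := hdom _ (Finset.subset_insert _ _) x i hi
        subst hii
        have hxy := hi y (mem_insert_self _ _)
        rcases y with y | j
        · have := hx y (mem_univ _)
          rw [f_inl, f_inl] at hxy
          rw [hρ _ (le_antisymm this (by omega))]
        · have hj : j = i₀ := by
            by_contra hj
            exact hy ((hout_inr j).mpr hj)
          rw [f_inr, if_pos hj, f_inl] at hxy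
          omega
      · rintro rfl
        refine ⟨hout_inl x, ?_⟩
        rintro (z | j)
        · refine ⟨i₀, fun y hy => ?_⟩
          rcases mem_insert.mp hy with rfl | hy
          · rw [f_inl, f_inl]
            have := hx z (mem_univ _)
            omega
          · obtain ⟨j, hj, rfl⟩ := mem_image.mp hy
            exact (f_lt _ _ _ (mem_erase.mp hj).1).le
        · exact ⟨j, hinr j _⟩
    have hrest : Even (∑ τ ∈ doors.erase out, #(rooms.bipartiteAbove (fun τ R => τ ⊆ R) τ)) := by
      refine Finset.even_sum _ fun τ hτ => ?_
      obtain ⟨hne, hτ⟩ := mem_erase.mp hτ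
      rw [hext τ hτ]
      obtain ⟨hτd, hτc, hτi⟩ := (mem_filter.mp hτ).2
      obtain ⟨x, hx⟩ : ∃ x, Sum.inl x ∈ τ := by
        by_contra! hno
        apply hne
        have h1 : ∀ j, Sum.inr j ∈ τ ↔ j ≠ i₀ := by
          intro j
          have : j ∈ τ.image d ↔ j ≠ i₀ := by rw [hτi]; simp
          rw [← this, mem_image]
          constructor
          · intro h
            exact ⟨_, h, rfl⟩
          · rintro ⟨y | k, hy, rfl⟩
            · exact absurd hy (hno y)
            · exact hy
        ext y
        rcases y with y | j
        · exact iff_of_false (hno y) (hout_inl y)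
        · rw [h1, hout_inr]
      rw [hτd.card_extensions hf hτc ⟨_, hx⟩
        fun i => ⟨Sum.inr i, fun l hl => ⟨_, hx, f_lt l i x hl.symm⟩⟩]
      exact even_two
    rw [← Finset.add_sum_erase _ _ hout_mem, hext out hout_mem, hout_one] at hcount
    rw [← hcount] at hrooms
    exact (Nat.not_even_iff_odd.mpr (hrest.one_add)) hrooms
  refine ⟨univ.filter fun x => Sum.inl x ∈ R, univ.filter fun i => Sum.inr i ∉ R, ?_, ?_⟩
  · intro x
    obtain ⟨i, hi⟩ := hR (Sum.inl x)
    refine ⟨i, ?_, fun y hy => ?_⟩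
    · simp only [mem_filter, mem_univ, true_and]
      intro h
      have := hi _ h
      rw [f_inr, if_pos rfl, f_inl] at this
      omega
    · have := hi _ (mem_filter.mp hy).2
      rw [f_inl, f_inl] at this
      omega
  · intro i hi
    have : i ∈ R.image d := by rw [hRc]; exact mem_univ _
    obtain ⟨y | j, hy, rfl⟩ := mem_image.mp this
    · exact ⟨y, by simpa using hy, rfl⟩
    · exact absurd hy (mem_filter.mp hi).2

/-- For any coloring of the grid points of the dilated simplex, there is a grid point such that
every color `i` is attained nearby, or else the `i`-th coordinate is small. -/
theorem exists_grid_point_near_colors {I : Type} [Fintype I] [Nonempty I] (m : ℕ)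
    (c : (I → ℕ) → I) :
    ∃ y₀ : I → ℕ, ∑ i, y₀ i = m ∧ ∀ i, y₀ i ≤ Fintype.card I ∨
      ∃ y : I → ℕ, ∑ i, y i = m ∧ c y = i ∧
        ∀ l, y l ≤ y₀ l + Fintype.card I ∧ y₀ l ≤ y l + Fintype.card I := by
  classical
  let X := Finset.piAntidiag (univ : Finset I) m
  have hX : ∀ x : I → ℕ, x ∈ X ↔ ∑ i, x i = m := by simp [X]
  have : Nonempty X := by
    let i₀ := Classical.arbitrary I
    exact ⟨⟨Pi.single i₀ m, (hX _).mpr (by simp)⟩⟩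
  let e := Fintype.equivFin X
  let K := Fintype.card X
  let ρ : I → X → ℕ := fun i x => (x : I → ℕ) i * K + e x
  have hle : ∀ i x y, ρ i x ≤ ρ i y → (x : I → ℕ) i ≤ (y : I → ℕ) i := by
    intro i x y h
    by_contra! hlt
    have h1 : ((y : I → ℕ) i + 1) * K ≤ (x : I → ℕ) i * K := Nat.mul_le_mul_right _ hlt
    have h2 : (e y : ℕ) < K := (e y).2
    have h3 : (x : I → ℕ) i * K + e x ≤ (y : I → ℕ) i * K + e y := h
    rw [add_mul] at h1
    omega
  have hρ : ∀ i, Function.Injective (ρ i) := by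
    intro i x y h
    have h1 := le_antisymm (hle i x y h.le) (hle i y x h.ge)
    have h2 : (x : I → ℕ) i * K + e x = (y : I → ℕ) i * K + e y := h
    rw [h1] at h2
    exact e.injective (Fin.ext (by omega))
  obtain ⟨σ, C, hdom, hcol⟩ := exists_dominant_colorful ρ hρ fun x => c x
  have hσ : σ.Nonempty := by
    obtain ⟨i, hi, -⟩ := hdom (Classical.arbitrary X)
    obtain ⟨y, hy, -⟩ := hcol i hi
    exact ⟨y, hy⟩
  have hmin : ∀ i, ∃ y ∈ σ, ∀ z ∈ σ, (y : I → ℕ) i ≤ (z : I → ℕ) i := fun i =>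
    Finset.exists_min_image σ (fun z => (z : I → ℕ) i) hσ
  choose w hwσ hw using hmin
  let k : I → ℕ := fun i => (w i : I → ℕ) i
  have hk : ∀ i, ∀ z ∈ σ, k i ≤ (z : I → ℕ) i := hw
  have hsum : m < ∑ i ∈ C, (k i + 1) := by
    by_contra! hle'
    obtain ⟨i₁, hi₁, -⟩ := hdom (Classical.arbitrary X)
    let x : I → ℕ := (fun i => if i ∈ C then k i + 1 else 0) +
      Pi.single i₁ (m - ∑ i ∈ C, (k i + 1))
    have hx : x ∈ X := by
      rw [hX]
      simp only [x, Pi.add_apply, Finset.sum_add_distrib, Finset.sum_ite_mem, Finset.univ_inter,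
        Finset.sum_pi_single', mem_univ, if_true]
      rw [Finset.sum_add_distrib] at hle'
      omega
    obtain ⟨i, hi, hxi⟩ := hdom ⟨x, hx⟩
    have h1 : x i ≤ k i := hle i _ _ (hxi _ (hwσ i))
    have h2 : k i + 1 ≤ x i := by simp [x, hi]
    omega
  have hcardC : #C ≤ Fintype.card I := Finset.card_le_univ C
  rw [Finset.sum_add_distrib, Finset.sum_const, smul_eq_mul, mul_one] at hsum
  have htot : ∀ z : X, ∑ i ∈ C, (z : I → ℕ) i + ∑ i ∈ Cᶜ, (z : I → ℕ) i = m := fun z => by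
    rw [Finset.sum_add_sum_compl, (hX _).mp z.2]
  have hnot : ∀ z ∈ σ, ∀ i ∉ C, (z : I → ℕ) i ≤ Fintype.card I := by
    intro z hz i hi
    have h1 := htot z
    have h2 : ∑ i ∈ C, k i ≤ ∑ i ∈ C, (z : I → ℕ) i := Finset.sum_le_sum fun i _ => hk i z hz
    have h3 : (z : I → ℕ) i ≤ ∑ i ∈ Cᶜ, (z : I → ℕ) i :=
      Finset.single_le_sum (f := (z : I → ℕ)) (fun _ _ => Nat.zero_le _) (by simpa using hi)
    omega
  have hin : ∀ z ∈ σ, ∀ i ∈ C, (z : I → ℕ) i ≤ k i + Fintype.card I := by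
    intro z hz i hi
    have h1 := htot z
    have h2 : ∑ i ∈ C.erase i, k i ≤ ∑ i ∈ C.erase i, (z : I → ℕ) i :=
      Finset.sum_le_sum fun i _ => hk i z hz
    rw [← Finset.add_sum_erase C _ hi] at h1
    rw [← Finset.add_sum_erase C _ hi] at hsum
    omega
  have hnear : ∀ y ∈ σ, ∀ z ∈ σ, ∀ l, (y : I → ℕ) l ≤ (z : I → ℕ) l + Fintype.card I := by
    intro y hy z hz l
    by_cases hl : l ∈ C
    · have := hin y hy l hl
      have := hk l z hz
      omega
    · have := hnot y hy l hl
      omega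
  obtain ⟨y₀, hy₀⟩ := hσ
  refine ⟨y₀, (hX _).mp y₀.2, fun i => ?_⟩
  by_cases hi : i ∈ C
  · obtain ⟨y, hy, hyi⟩ := hcol i hi
    exact Or.inr ⟨y, (hX _).mp y.2, hyi, fun l => ⟨hnear _ hy _ hy₀ l, hnear _ hy₀ _ hy l⟩⟩
  · exact Or.inl (hnot y₀ hy₀ i hi)

/-- **Brouwer's fixed point theorem** for the standard simplex. -/
theorem exists_fixedPoint_stdSimplex {I : Type} [Fintype I] [Nonempty I] {f : (I → ℝ) → I → ℝ}
    (hf : ContinuousOn f (stdSimplex ℝ I))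
    (hmaps : Set.MapsTo f (stdSimplex ℝ I) (stdSimplex ℝ I)) :
    ∃ x ∈ stdSimplex ℝ I, f x = x := by
  classical
  have hcompact : IsCompact (stdSimplex ℝ I) := isCompact_stdSimplex ℝ I
  have hΔne : (stdSimplex ℝ I).Nonempty := ⟨_, single_mem_stdSimplex ℝ (Classical.arbitrary I)⟩
  let g : (I → ℝ) → ℝ := fun x => ∑ i, max 0 (x i - f x i)
  have hg : ContinuousOn g (stdSimplex ℝ I) := by
    refine continuousOn_finsetSum _ fun i _ => continuousOn_const.sup ?_
    exact (continuous_apply i).continuousOn.sub ((continuous_apply i).comp_continuousOn hf)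
  obtain ⟨x, hx, hxmin⟩ := hcompact.exists_isMinOn hΔne hg
  have hn : (0 : ℝ) < Fintype.card I := by exact_mod_cast Fintype.card_pos
  have happrox : ∀ ε > 0, ∃ y ∈ stdSimplex ℝ I, ∀ i, y i - f y i ≤ ε := by
    intro ε hε
    obtain ⟨δ, hδ, huc⟩ := Metric.uniformContinuousOn_iff.mp
      (hcompact.uniformContinuousOn_of_continuous hf) (ε / 2) (half_pos hε)
    obtain ⟨m, hm⟩ := exists_nat_gt (Fintype.card I / min δ (ε / 2))
    have hmin : 0 < min δ (ε / 2) := lt_min hδ (half_pos hε)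
    have hm0 : (0 : ℝ) < m := (div_pos hn hmin).trans hm
    have hsmall : (Fintype.card I : ℝ) / m < min δ (ε / 2) := by
      rw [div_lt_comm₀ hm0 hmin]
      exact hm
    let p : (I → ℕ) → I → ℝ := fun y i => y i / m
    have hp : ∀ y : I → ℕ, ∑ i, y i = m → p y ∈ stdSimplex ℝ I := by
      intro y hy
      refine ⟨fun i => by positivity, ?_⟩
      rw [← Finset.sum_div, ← Nat.cast_sum, hy, div_self hm0.ne']
    have hcolor : ∀ y : I → ℕ, ∃ i, ∑ i, y i = m → p y i ≤ f (p y) i := by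
      intro y
      by_contra! hcon
      have hy := (hcon (Classical.arbitrary I)).1
      have := Finset.sum_lt_sum_of_nonempty univ_nonempty fun i _ => (hcon i).2
      rw [(hp y hy).2, (hmaps (hp y hy)).2] at this
      exact lt_irrefl _ this
    choose c hc using hcolor
    obtain ⟨y₀, hy₀, h⟩ := exists_grid_point_near_colors m c
    refine ⟨p y₀, hp y₀ hy₀, fun i => ?_⟩
    rcases h i with h | ⟨y, hy, rfl, hnear⟩
    · have h1 : p y₀ i ≤ Fintype.card I / m := by
        have : (y₀ i : ℝ) ≤ Fintype.card I := by exact_mod_cast h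
        exact div_le_div_of_nonneg_right this hm0.le
      have h2 := (hmaps (hp y₀ hy₀)).1 i
      have h3 := min_le_right δ (ε / 2)
      linarith
    · have hcoord : ∀ l, |p y l - p y₀ l| ≤ Fintype.card I / m := by
        intro l
        rw [abs_le]
        have h1 : (y l : ℝ) ≤ y₀ l + Fintype.card I := by exact_mod_cast (hnear l).1
        have h2 : (y₀ l : ℝ) ≤ y l + Fintype.card I := by exact_mod_cast (hnear l).2
        constructor
        · rw [← neg_div, ← sub_div]
          exact div_le_div_of_nonneg_right (by linarith) hm0.le
        · rw [← sub_div]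
          exact div_le_div_of_nonneg_right (by linarith) hm0.le
      have hdist : dist (p y) (p y₀) < δ := by
        rw [dist_pi_lt_iff hδ]
        intro l
        exact (hcoord l).trans_lt (hsmall.trans_le (min_le_left _ _))
      have h1 := (dist_le_pi_dist _ _ (c y)).trans_lt (huc _ (hp y hy) _ (hp y₀ hy₀) hdist)
      rw [Real.dist_eq, abs_lt] at h1
      have h2 := hc y hy
      have h3 := (abs_le.mp (hcoord (c y))).1
      have h4 := min_le_right δ (ε / 2)
      linarith [h1.2]
  have hgx : g x ≤ 0 := by
    refine le_of_forall_pos_le_add fun ε hε => ?_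
    obtain ⟨y, hy, hyε⟩ := happrox (ε / Fintype.card I) (div_pos hε hn)
    calc g x ≤ g y := hxmin hy
      _ ≤ ∑ _i : I, ε / Fintype.card I :=
        Finset.sum_le_sum fun i _ => max_le (div_pos hε hn).le (hyε i)
      _ = 0 + ε := by
        rw [Finset.sum_const, Finset.card_univ, nsmul_eq_mul, mul_div_cancel₀ _ hn.ne', zero_add]
  have hle : ∀ i, x i ≤ f x i := by
    intro i
    have h1 : max 0 (x i - f x i) ≤ g x :=
      Finset.single_le_sum (f := fun i => max 0 (x i - f x i)) (fun _ _ => le_max_left _ _)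
        (mem_univ i)
    have h2 := le_max_right 0 (x i - f x i)
    linarith
  refine ⟨x, hx, ?_⟩
  have hsum : ∑ i, x i = ∑ i, f x i := by rw [hx.2, (hmaps hx).2]
  ext i
  exact ((Finset.sum_eq_sum_iff_of_le fun i _ => hle i).mp hsum i (mem_univ i)).symm

section Policies

theorem isProductPolicy_iff_mem_stdSimplex {N H : ℕ} {S : Type} {A : Fin N → Type}
    [∀ j, Fintype (A j)]
    {π : (j : Fin N) → Fin H → S → A j → ℝ} :
    IsProductPolicy π ↔ ∀ j h s, π j h s ∈ stdSimplex ℝ (A j) :=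
  Iff.rfl

theorem isCompact_setOf_isProductPolicy {N H : ℕ} {S : Type} {A : Fin N → Type}
    [∀ j, Fintype (A j)] :
    IsCompact {π : (j : Fin N) → Fin H → S → A j → ℝ | IsProductPolicy π} := by
  have h : IsCompact (Set.univ.pi fun j : Fin N => Set.univ.pi fun _ : Fin H =>
      Set.univ.pi fun _ : S => stdSimplex ℝ (A j)) :=
    isCompact_univ_pi fun j => isCompact_univ_pi fun _ => isCompact_univ_pi fun _ =>
      isCompact_stdSimplex ℝ (A j)
  convert h using 1
  ext π
  simp only [Set.mem_ofPred_eq, isProductPolicy_iff_mem_stdSimplex, Set.mem_pi, Set.mem_univ,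
    true_imp_iff]

/-- A continuous self-map of the set of product policies has a fixed point. -/
theorem exists_fixedPoint_isProductPolicy [Nonempty S] [∀ j, Nonempty (A j)] (hN : 1 ≤ N)
    (hH : 1 ≤ H)
    {f : ((j : Fin N) → Fin H → S → A j → ℝ) → (j : Fin N) → Fin H → S → A j → ℝ}
    (hf : ContinuousOn f {π | IsProductPolicy π})
    (hmaps : ∀ π, IsProductPolicy π → IsProductPolicy (f π)) :
    ∃ π, IsProductPolicy π ∧ f π = π := by
  classical
  let T := Σ j : Fin N, Fin H × S × A j
  have : Nonempty T :=
    ⟨⟨⟨0, hN⟩, ⟨0, hH⟩, Classical.arbitrary S, Classical.arbitrary (A ⟨0, hN⟩)⟩⟩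
  let B : ℝ := N * (H * Fintype.card S)
  have hB : 0 < B := by
    have h1 : 0 < Fintype.card S := Fintype.card_pos
    have : 0 < N * (H * Fintype.card S) := by positivity
    simp only [B]
    exact_mod_cast this
  let σ : (T → ℝ) → (j : Fin N) → Fin H → S → ℝ := fun x j h s => ∑ a, B * x ⟨j, h, s, a⟩
  let q : (T → ℝ) → (j : Fin N) → Fin H → S → A j → ℝ := fun x j h s a =>
    (B * x ⟨j, h, s, a⟩ + max 0 (1 - σ x j h s) / Fintype.card (A j)) / max 1 (σ x j h s)
  have hpos : ∀ x j h s, 0 < max 1 (σ x j h s) := fun x j h s =>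
    lt_of_lt_of_le one_pos (le_max_left _ _)
  have hq_cont : Continuous q := by
    refine continuous_pi fun j => continuous_pi fun h => continuous_pi fun s =>
      continuous_pi fun a => ?_
    have hσ : Continuous fun x => σ x j h s :=
      continuous_finsetSum _ fun a _ => continuous_const.mul (continuous_apply _)
    refine Continuous.div₀ ?_ (continuous_const.max hσ) fun x => (hpos x j h s).ne'
    exact (continuous_const.mul (continuous_apply _)).add
      ((continuous_const.max (continuous_const.sub hσ)).div_const _)
  have hq_mem : ∀ x, (∀ t, 0 ≤ x t) → IsProductPolicy (q x) := by
    intro x hx j h s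
    refine ⟨fun a => ?_, ?_⟩
    · refine div_nonneg (add_nonneg (mul_nonneg hB.le (hx _)) ?_) (hpos x j h s).le
      exact div_nonneg (le_max_left _ _) (Nat.cast_nonneg _)
    · simp only [q]
      rw [← Finset.sum_div, Finset.sum_add_distrib, div_eq_one_iff_eq (hpos x j h s).ne',
        Finset.sum_const, Finset.card_univ, nsmul_eq_mul,
        mul_div_cancel₀ _ (by exact_mod_cast Fintype.card_ne_zero)]
      change σ x j h s + _ = _
      rcases le_total (σ x j h s) 1 with h1 | h1
      · rw [max_eq_left h1, max_eq_right (by linarith)]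
        ring
      · rw [max_eq_right h1, max_eq_left (by linarith)]
        ring
  have hq_eq : ∀ (x : T → ℝ) (π : (j : Fin N) → Fin H → S → A j → ℝ), IsProductPolicy π →
      (∀ j h s a, x ⟨j, h, s, a⟩ = π j h s a / B) → q x = π := by
    intro x π hπ hx
    have hx' : ∀ j h s a, B * x ⟨j, h, s, a⟩ = π j h s a := fun j h s a => by
      rw [hx, mul_div_cancel₀ _ hB.ne']
    have hσ : ∀ j h s, σ x j h s = 1 := fun j h s => by
      simp only [σ, hx']
      exact (hπ j h s).2
    ext j h s a
    simp only [q, hx', hσ]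
    simp
  have hsum : ∀ π : (j : Fin N) → Fin H → S → A j → ℝ, IsProductPolicy π →
      ∑ t : T, π t.1 t.2.1 t.2.2.1 t.2.2.2 / B = 1 := by
    intro π hπ
    rw [← Finset.sum_div, div_eq_one_iff_eq hB.ne', Fintype.sum_sigma]
    simp only [Fintype.sum_prod_type]
    simp only [(hπ _ _ _).2, B]
    simp
  obtain ⟨x, hx, hxf⟩ := exists_fixedPoint_stdSimplex
    (f := fun x (t : T) => f (q x) t.1 t.2.1 t.2.2.1 t.2.2.2 / B)
    (by
      have hfq : ContinuousOn (fun x => f (q x)) (stdSimplex ℝ T) :=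
        hf.comp hq_cont.continuousOn fun x hx => hq_mem x hx.1
      refine continuousOn_pi.mpr fun t => ContinuousOn.div_const ?_ _
      have h1 := continuousOn_pi.mp hfq t.1
      have h2 := continuousOn_pi.mp h1 t.2.1
      exact continuousOn_pi.mp (continuousOn_pi.mp h2 t.2.2.1) t.2.2.2)
    (fun x hx => ⟨fun t => div_nonneg ((hmaps _ (hq_mem x hx.1) _ _ _).1 _) hB.le,
      hsum _ (hmaps _ (hq_mem x hx.1))⟩)
  refine ⟨q x, hq_mem x hx.1, ?_⟩
  exact (hq_eq x _ (hmaps _ (hq_mem x hx.1)) fun j h s a => (congrFun hxf ⟨j, h, s, a⟩).symm).symm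

end Policies

section Occupancy

open Classical in
/-- The probability that the state at (zero-based) step `t` is `s` under the profile `π`. -/
noncomputable def occupancy (G : MOMG N M H S A) (s1 : S)
    (π : (j : Fin N) → Fin H → S → A j → ℝ) : ℕ → S → ℝ
  | 0, s => if s = s1 then 1 else 0
  | (t+1), s' =>
    if ht : t < H then
      ∑ s, ∑ a : (j : Fin N) → A j, occupancy G s1 π t s * (∏ j, π j ⟨t, ht⟩ s (a j)) *
        G.P ⟨t, ht⟩ s a s'
    else 0

theorem occupancy_nonneg (G : MOMG N M H S A) (s1 : S)
    {π : (j : Fin N) → Fin H → S → A j → ℝ} (hπ : IsProductPolicy π) (t : ℕ) (s : S) :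
    0 ≤ occupancy G s1 π t s := by
  induction t generalizing s with
  | zero => rw [occupancy]; split_ifs <;> norm_num
  | succ t ih =>
    rw [occupancy]
    split_ifs with ht
    · exact Finset.sum_nonneg fun s' _ => Finset.sum_nonneg fun a _ => mul_nonneg
        (mul_nonneg (ih s') (Finset.prod_nonneg fun j _ => (hπ j _ _).1 _)) (G.P_nonneg _ _ _ _)
    · exact le_rfl

theorem continuous_prod_policy {N H : ℕ} {S : Type} {A : Fin N → Type}
    (h : Fin H) (s : S) (a : (j : Fin N) → A j) :
    Continuous fun π : (j : Fin N) → Fin H → S → A j → ℝ => ∏ j, π j h s (a j) :=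
  continuous_finsetProd _ fun j _ => (continuous_apply (a j)).comp ((continuous_apply s).comp
    ((continuous_apply h).comp (continuous_apply j)))

theorem continuous_occupancy (G : MOMG N M H S A) (s1 : S) (t : ℕ) (s : S) :
    Continuous fun π => occupancy G s1 π t s := by
  induction t generalizing s with
  | zero => simp only [occupancy]; exact continuous_const
  | succ t ih =>
    simp only [occupancy]
    split_ifs with ht
    · exact continuous_finsetSum _ fun s' _ => continuous_finsetSum _ fun a _ =>
        ((ih s').mul (continuous_prod_policy _ _ _)).mul continuous_const
    · exact continuous_const

theorem Vvec_sub (G : MOMG N M H S A) (k : Fin N) (π : (j : Fin N) → Fin H → S → A j → ℝ)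
    {t : ℕ} (ht : t < H) (s : S) (i : Fin M) :
    Vvec G k π (H - t) s i = ∑ a : (j : Fin N) → A j, (∏ j, π j ⟨t, ht⟩ s (a j)) *
      (G.r k ⟨t, ht⟩ s a i + ∑ s', G.P ⟨t, ht⟩ s a s' * Vvec G k π (H - (t + 1)) s' i) := by
  obtain ⟨n, hn⟩ : ∃ n, H - t = n + 1 := ⟨H - t - 1, by omega⟩
  have hn' : H - (t + 1) = n := by omega
  have hlt : H - (n + 1) < H := by omega
  have hfin : (⟨H - (n + 1), hlt⟩ : Fin H) = ⟨t, ht⟩ := Fin.ext (by simp only; omega)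
  rw [hn, hn', Vvec, dif_pos hlt, hfin]

/-- The value vector is the sum of the rewards weighted by the occupancies. -/
theorem ValueVec_eq_sum_occupancy (G : MOMG N M H S A) (k : Fin N)
    (π : (j : Fin N) → Fin H → S → A j → ℝ) (s1 : S) (i : Fin M) :
    ValueVec G k π s1 i = ∑ h : Fin H, ∑ s, ∑ a : (j : Fin N) → A j,
      occupancy G s1 π h s * (∏ j, π j h s (a j)) * G.r k h s a i := by
  classical
  let F : ℕ → ℝ := fun t => if ht : t < H then ∑ s, ∑ a : (j : Fin N) → A j,
      occupancy G s1 π t s * (∏ j, π j ⟨t, ht⟩ s (a j)) * G.r k ⟨t, ht⟩ s a i else 0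
  have key : ∀ t ≤ H, ValueVec G k π s1 i =
      ∑ h ∈ range t, F h + ∑ s, occupancy G s1 π t s * Vvec G k π (H - t) s i := by
    intro t ht
    induction t with
    | zero => simp [ValueVec, occupancy]
    | succ t ih =>
      have ht' : t < H := ht
      rw [ih ht'.le, Finset.sum_range_succ, add_assoc]
      congr 1
      simp only [F, dif_pos ht', occupancy, Vvec_sub G k π ht']
      simp only [Finset.mul_sum, Finset.sum_mul, mul_add, Finset.sum_add_distrib]
      congr 1
      · simp only [mul_assoc]
      · rw [Finset.sum_comm (s := univ (α := S)) (t := univ (α := S))]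
        refine Finset.sum_congr rfl fun s _ => ?_
        rw [Finset.sum_comm]
        simp only [mul_assoc]
  rw [key H le_rfl, Finset.sum_range]
  simp [F, Vvec]

theorem continuous_ValueVec (G : MOMG N M H S A) (k : Fin N) (s1 : S) :
    Continuous fun π => ValueVec G k π s1 := by
  refine continuous_pi fun i => ?_
  simp only [ValueVec_eq_sum_occupancy]
  exact continuous_finsetSum _ fun h _ => continuous_finsetSum _ fun s _ =>
    continuous_finsetSum _ fun a _ =>
      ((continuous_occupancy G s1 h s).mul (continuous_prod_policy _ _ _)).mul continuous_const

theorem prod_update_policy {N H : ℕ} {S : Type} {A : Fin N → Type}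
    (π : (j : Fin N) → Fin H → S → A j → ℝ) (k : Fin N)
    (ρ : Fin H → S → A k → ℝ) (h : Fin H) (s : S) (a : (j : Fin N) → A j) :
    ∏ j, Function.update π k ρ j h s (a j) =
      ρ h s (a k) * ∏ j ∈ univ.erase k, π j h s (a j) := by
  rw [← Finset.mul_prod_erase univ _ (mem_univ k), Function.update_self]
  congr 1
  refine Finset.prod_congr rfl fun j hj => ?_
  rw [Function.update_of_ne (mem_erase.mp hj).1]

variable {G : MOMG N M H S A} {s1 : S} {π : (j : Fin N) → Fin H → S → A j → ℝ} {k : Fin N}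
  {F : Finset (Fin H → S → A k → ℝ)} {w : (Fin H → S → A k → ℝ) → ℝ}

/-- If the policy of agent `k` is, at every state, the mixture of the policies `ρ ∈ F` with
weights proportional to `w ρ` times their occupancies, then so are the joint occupancies. -/
theorem occupancy_mul_prod_eq_sum_of_mixture {h : Fin H} {s : S}
    (hocc : occupancy G s1 π h s =
      ∑ ρ ∈ F, w ρ * occupancy G s1 (Function.update π k ρ) h s)
    (hmix : ∀ a, π k h s a * ∑ ρ ∈ F, w ρ * occupancy G s1 (Function.update π k ρ) h s =
      ∑ ρ ∈ F, w ρ * occupancy G s1 (Function.update π k ρ) h s * ρ h s a)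
    (a : (j : Fin N) → A j) :
    occupancy G s1 π h s * ∏ j, π j h s (a j) =
      ∑ ρ ∈ F, w ρ * (occupancy G s1 (Function.update π k ρ) h s *
        ∏ j, Function.update π k ρ j h s (a j)) := by
  simp only [prod_update_policy]
  rw [← Finset.mul_prod_erase univ _ (mem_univ k), hocc, ← mul_assoc, mul_comm _ (π k h s (a k)),
    hmix, Finset.sum_mul]
  exact Finset.sum_congr rfl fun ρ _ => by ring

theorem occupancy_eq_sum_of_mixture (hw : ∑ ρ ∈ F, w ρ = 1)
    (hmix : ∀ (h : Fin H) s a,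
      π k h s a * ∑ ρ ∈ F, w ρ * occupancy G s1 (Function.update π k ρ) h s =
        ∑ ρ ∈ F, w ρ * occupancy G s1 (Function.update π k ρ) h s * ρ h s a) (t : ℕ) (s : S) :
    occupancy G s1 π t s = ∑ ρ ∈ F, w ρ * occupancy G s1 (Function.update π k ρ) t s := by
  induction t generalizing s with
  | zero => simp only [occupancy]; rw [← Finset.sum_mul, hw, one_mul]
  | succ t ih =>
    simp only [occupancy]
    split_ifs with ht
    · simp only [occupancy_mul_prod_eq_sum_of_mixture (h := ⟨t, ht⟩) (ih _)
        (hmix ⟨t, ht⟩ _), Finset.sum_mul, Finset.mul_sum]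
      simp only [Finset.sum_comm (t := F), mul_assoc]
    · simp

theorem ValueVec_eq_sum_of_mixture (hw : ∑ ρ ∈ F, w ρ = 1)
    (hmix : ∀ (h : Fin H) s a,
      π k h s a * ∑ ρ ∈ F, w ρ * occupancy G s1 (Function.update π k ρ) h s =
        ∑ ρ ∈ F, w ρ * occupancy G s1 (Function.update π k ρ) h s * ρ h s a) :
    ValueVec G k π s1 = ∑ ρ ∈ F, w ρ • ValueVec G k (Function.update π k ρ) s1 := by
  ext i
  simp only [Finset.sum_apply, Pi.smul_apply, smul_eq_mul, ValueVec_eq_sum_occupancy,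
    occupancy_mul_prod_eq_sum_of_mixture (occupancy_eq_sum_of_mixture hw hmix _ _) (hmix _ _),
    Finset.sum_mul, Finset.mul_sum]
  simp only [Finset.sum_comm (t := F), mul_assoc]

end Occupancy

theorem IsProductPolicy.update {N H : ℕ} {S : Type} {A : Fin N → Type}
    [∀ j, Fintype (A j)] {π : (j : Fin N) → Fin H → S → A j → ℝ} (hπ : IsProductPolicy π) {k : Fin N} {ρ : Fin H → S → A k → ℝ} (hρ : IsPolicy ρ) :
    IsProductPolicy (Function.update π k ρ) := by
  intro j
  by_cases hj : j = k
  · subst hj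
    rwa [Function.update_self]
  · rw [Function.update_of_ne hj]
    exact hπ j

/-- There is a product policy which is optimal against any given finite set of deviations. -/
theorem exists_isProductPolicy_finset_le [Nonempty S] [∀ j, Nonempty (A j)] (hN : 1 ≤ N)
    (hH : 1 ≤ H) (G : MOMG N M H S A) (u : Fin N → (Fin M → ℝ) → ℝ)
    (hu_cont : ∀ k, Continuous (u k))
    (hu_qc : ∀ k, QuasiconcaveOn ℝ Set.univ (u k)) (s1 : S)
    (F : (k : Fin N) → Finset (Fin H → S → A k → ℝ)) (hF : ∀ k, ∀ ρ ∈ F k, IsPolicy ρ) :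
    ∃ π : (j : Fin N) → Fin H → S → A j → ℝ, IsProductPolicy π ∧
      ∀ k, ∀ ρ ∈ F k,
        u k (ValueVec G k (Function.update π k ρ) s1) ≤ u k (ValueVec G k π s1) := by
  let gain : ((j : Fin N) → Fin H → S → A j → ℝ) → (k : Fin N) → (Fin H → S → A k → ℝ) → ℝ :=
    fun π k ρ => max 0
      (u k (ValueVec G k (Function.update π k ρ) s1) - u k (ValueVec G k π s1))
  let occ : ((j : Fin N) → Fin H → S → A j → ℝ) → (k : Fin N) → (Fin H → S → A k → ℝ) →
      Fin H → S → ℝ := fun π k ρ h s => occupancy G s1 (Function.update π k ρ) h s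
  have hupd : ∀ k (ρ : Fin H → S → A k → ℝ),
      Continuous fun π : (j : Fin N) → Fin H → S → A j → ℝ => Function.update π k ρ :=
    fun k ρ => continuous_id.update k continuous_const
  have hgain_cont : ∀ k ρ, Continuous fun π => gain π k ρ := fun k ρ =>
    continuous_const.max (((hu_cont k).comp ((continuous_ValueVec G k s1).comp (hupd k ρ))).sub
      ((hu_cont k).comp (continuous_ValueVec G k s1)))
  have hocc_cont : ∀ k ρ h s, Continuous fun π => occ π k ρ h s := fun k ρ h s =>
    (continuous_occupancy G s1 h s).comp (hupd k ρ)
  have hgain_nonneg : ∀ π k ρ, 0 ≤ gain π k ρ := fun _ _ _ => le_max_left _ _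
  have hocc_nonneg : ∀ π, IsProductPolicy π → ∀ k, ∀ ρ ∈ F k, ∀ h s, 0 ≤ occ π k ρ h s :=
    fun π hπ k ρ hρ h s => occupancy_nonneg G s1 (hπ.update (hF k ρ hρ)) h s
  have hden : ∀ π, IsProductPolicy π → ∀ k h s,
      0 < 1 + ∑ ρ ∈ F k, gain π k ρ * occ π k ρ h s := fun π hπ k h s =>
    add_pos_of_pos_of_nonneg one_pos (Finset.sum_nonneg fun ρ hρ =>
      mul_nonneg (hgain_nonneg π k ρ) (hocc_nonneg π hπ k ρ hρ h s))
  obtain ⟨π, hπ, hfix⟩ := exists_fixedPoint_isProductPolicy hN hH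
    (f := fun π k h s a => (π k h s a + ∑ ρ ∈ F k, gain π k ρ * occ π k ρ h s * ρ h s a) /
      (1 + ∑ ρ ∈ F k, gain π k ρ * occ π k ρ h s))
    (by
      refine continuousOn_pi.mpr fun k => continuousOn_pi.mpr fun h => continuousOn_pi.mpr
        fun s => continuousOn_pi.mpr fun a => ContinuousOn.div ?_ ?_
          fun π hπ => (hden π hπ k h s).ne'
      · refine Continuous.continuousOn (Continuous.add ?_ ?_)
        · exact (continuous_apply a).comp ((continuous_apply s).comp
            ((continuous_apply h).comp (continuous_apply k)))
        · exact continuous_finsetSum _ fun ρ _ =>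
            ((hgain_cont k ρ).mul (hocc_cont k ρ h s)).mul continuous_const
      · exact (continuous_const.add (continuous_finsetSum _ fun ρ _ =>
          (hgain_cont k ρ).mul (hocc_cont k ρ h s))).continuousOn)
    (by
      intro π hπ k h s
      refine ⟨fun a => div_nonneg (add_nonneg ((hπ k h s).1 a) ?_) (hden π hπ k h s).le, ?_⟩
      · exact Finset.sum_nonneg fun ρ hρ => mul_nonneg (mul_nonneg (hgain_nonneg π k ρ)
          (hocc_nonneg π hπ k ρ hρ h s)) ((hF k ρ hρ h s).1 a)
      · rw [← Finset.sum_div, div_eq_one_iff_eq (hden π hπ k h s).ne', Finset.sum_add_distrib,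
          (hπ k h s).2, Finset.sum_comm]
        congr 1
        refine Finset.sum_congr rfl fun ρ hρ => ?_
        rw [← Finset.mul_sum, (hF k ρ hρ h s).2, mul_one])
  refine ⟨π, hπ, fun k => ?_⟩
  have hmix : ∀ h s a, π k h s a * ∑ ρ ∈ F k, gain π k ρ * occ π k ρ h s =
      ∑ ρ ∈ F k, gain π k ρ * occ π k ρ h s * ρ h s a := by
    intro h s a
    have := congrFun (congrFun (congrFun (congrFun hfix k) h) s) a
    rw [div_eq_iff (hden π hπ k h s).ne'] at this
    linarith
  by_contra! hcon
  obtain ⟨ρ₀, hρ₀, hlt⟩ := hcon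
  have hpos : 0 < ∑ ρ ∈ F k, gain π k ρ :=
    Finset.sum_pos' (fun ρ _ => hgain_nonneg π k ρ)
      ⟨ρ₀, hρ₀, lt_max_of_lt_right (sub_pos.mpr hlt)⟩
  let w : (Fin H → S → A k → ℝ) → ℝ := fun ρ => gain π k ρ / ∑ ρ ∈ F k, gain π k ρ
  have hw : ∑ ρ ∈ F k, w ρ = 1 := by rw [← Finset.sum_div, div_self hpos.ne']
  have hval := ValueVec_eq_sum_of_mixture (G := G) (s1 := s1) (π := π) (w := w) hw (by
    intro h s a
    have h1 := congrArg (· / ∑ ρ ∈ F k, gain π k ρ) (hmix h s a)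
    simp only [mul_div_assoc, Finset.sum_div] at h1
    convert h1 using 2
    · exact Finset.sum_congr rfl fun ρ _ => by simp only [w, occ]; ring
    · simp only [w, occ]; ring)
  have hconv := (hu_qc k).convex_gt (u k (ValueVec G k π s1))
  classical
  have hmem : ∑ ρ ∈ F k with w ρ ≠ 0, w ρ • ValueVec G k (Function.update π k ρ) s1 ∈
      {x ∈ Set.univ | u k (ValueVec G k π s1) < u k x} := by
    refine hconv.sum_mem (fun ρ _ => div_nonneg (hgain_nonneg π k ρ) hpos.le)
      (by rw [Finset.sum_filter_ne_zero, hw]) fun ρ hρ => ⟨Set.mem_univ _, ?_⟩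
    by_contra! hle
    apply (mem_filter.mp hρ).2
    simp only [w, gain, max_eq_left (sub_nonpos.mpr hle), zero_div]
  have hfilter : ∑ ρ ∈ F k with w ρ ≠ 0, w ρ • ValueVec G k (Function.update π k ρ) s1 =
      ∑ ρ ∈ F k, w ρ • ValueVec G k (Function.update π k ρ) s1 :=
    Finset.sum_filter_of_ne fun ρ _ h h0 => h (by rw [h0, zero_smul])
  rw [hfilter, ← hval] at hmem
  exact lt_irrefl _ hmem.2

/-- **Existence of an SER Nash Equilibrium for continuous quasi-concave
utilities.** If each utility `u_k : ℝ^M → ℝ` is continuous and quasi-concave,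
then there is a product policy `π*` such that for every agent `k` and every
unilateral deviation `π_k`,
`u_k(V_{k,1}^{(π_k, π*_{-k})}(s_1)) ≤ u_k(V_{k,1}^{π*}(s_1))`. -/
theorem exists_SER_NE {N M H : ℕ} (hN : 1 ≤ N) (hH : 1 ≤ H)
    (S : Type) (A : Fin N → Type) [Fintype S] [Nonempty S]
    [∀ j, Fintype (A j)] [∀ j, Nonempty (A j)]
    (G : MOMG N M H S A) (u : Fin N → (Fin M → ℝ) → ℝ)
    (hu_cont : ∀ k, Continuous (u k))
    (hu_qc : ∀ k, QuasiconcaveOn ℝ Set.univ (u k)) (s1 : S) :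
    ∃ πstar : (j : Fin N) → Fin H → S → A j → ℝ,
      IsProductPolicy πstar ∧
      ∀ k, ∀ ρ : Fin H → S → A k → ℝ, IsPolicy ρ →
        u k (ValueVec G k (Function.update πstar k ρ) s1) ≤
          u k (ValueVec G k πstar s1) := by
  classical
  let D := Σ k : Fin N, {ρ : Fin H → S → A k → ℝ // IsPolicy ρ}
  let stable : D → Set ((j : Fin N) → Fin H → S → A j → ℝ) := fun d =>
    {π | u d.1 (ValueVec G d.1 (Function.update π d.1 d.2) s1) ≤ u d.1 (ValueVec G d.1 π s1)}
  have hclosed : ∀ d, IsClosed (stable d) := fun d =>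
    isClosed_le ((hu_cont d.1).comp ((continuous_ValueVec G d.1 s1).comp
      (continuous_id.update d.1 continuous_const)))
      ((hu_cont d.1).comp (continuous_ValueVec G d.1 s1))
  obtain ⟨π, hπ, hstable⟩ := isCompact_setOf_isProductPolicy.inter_iInter_nonempty stable hclosed
    (by
      intro T
      obtain ⟨π, hπ, h⟩ := exists_isProductPolicy_finset_le hN hH G u hu_cont hu_qc s1
        (fun k => (T.preimage (Sigma.mk k) sigma_mk_injective.injOn).map
          (Function.Embedding.subtype _))
        (by
          intro k ρ hρ
          obtain ⟨ρ, -, rfl⟩ := mem_map.mp hρ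
          exact ρ.2)
      refine ⟨π, hπ, Set.mem_iInter₂.mpr fun d hd => ?_⟩
      exact h d.1 d.2 (mem_map_of_mem _ (Finset.mem_preimage.mpr hd)))
  exact ⟨π, hπ, fun k ρ hρ => Set.mem_iInter.mp hstable ⟨k, ρ, hρ⟩⟩
end

section
/- For a finite MOMG G, the set of Pareto Correlated Equilibria equals the union, over all preference profiles Λ = (λ^1,…,λ^N) with every λ^k in Δ_M^o (all entries strictly positive), of the sets of ex-ante correlated equilibria of the linearly scalarized games G_Λ: a joint policy σ is a PCE of G if and only if there exists such a Λ for which, for every player j and every stochastic modification φ_j, (λ^j)^⊤ V_{j,1}^{φ_j ∘ σ}(s_1) ≤ (λ^j)^⊤ V_{j,1}^{σ}(s_1). -/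
open Finset

variable {N M H : ℕ} {S : Type} {A : Fin N → Type} [Fintype S] [∀ j, Fintype (A j)]

/-- Histories: `Hist S JA h` records `s_1, a_1, s_2, …, a_h, s_{h+1}` (the
history available at step `h+1`, 0-indexed: `Hist S JA 0 = S`). -/
def Hist (S JA : Type) : ℕ → Type
  | 0 => S
  | h + 1 => Hist S JA h × JA × S

/-- The current (last) state of a history. -/
def lastState {S JA : Type} : (h : ℕ) → Hist S JA h → S
  | 0, s => s
  | _ + 1, x => x.2.2

/-- A history-dependent joint (possibly correlated) policy: at each step `h` it
assigns a distribution over joint actions given the history. -/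
def IsHistJointPolicy
    (σ : (h : Fin H) → Hist S ((j : Fin N) → A j) h.1 → ((j : Fin N) → A j) → ℝ) :
    Prop :=
  ∀ h hist, (∀ a, 0 ≤ σ h hist a) ∧ ∑ a, σ h hist a = 1

/-- Value vector of agent `j` under a history-dependent joint policy `σ`,
from a history of length `h`. -/
noncomputable def VvecH (G : MOMG N M H S A) (j : Fin N)
    (σ : (h : Fin H) → Hist S ((j' : Fin N) → A j') h.1 → ((j' : Fin N) → A j') → ℝ) :
    (h : ℕ) → Hist S ((j' : Fin N) → A j') h → Fin M → ℝ := fun h hist i =>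
  if hlt : h < H then
    ∑ a : (j' : Fin N) → A j', σ ⟨h, hlt⟩ hist a *
      (G.r j ⟨h, hlt⟩ (lastState h hist) a i +
        ∑ s', G.P ⟨h, hlt⟩ (lastState h hist) a s' *
          VvecH G j σ (h + 1) (hist, a, s') i)
  else 0
termination_by h => H - h

/-- The history-dependent joint policy induced by a Markov product policy. -/
def toHistPolicy (π : (j : Fin N) → Fin H → S → A j → ℝ) :
    (h : Fin H) → Hist S ((j : Fin N) → A j) h.1 → ((j : Fin N) → A j) → ℝ :=
  fun h hist a => ∏ j, π j h (lastState h.1 hist) (a j)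

/-- A stochastic modification for agent `k`: given the history and the sampled
action of agent `k`, a distribution over replacement actions. -/
def IsModification {k : Fin N}
    (φ : (h : Fin H) → Hist S ((j : Fin N) → A j) h.1 → A k → A k → ℝ) : Prop :=
  ∀ h hist b, (∀ a, 0 ≤ φ h hist b a) ∧ ∑ a, φ h hist b a = 1

/-- The modified joint policy `φ ∘ σ`: sample a joint action from `σ`, then
resample agent `k`'s component according to `φ`. -/
noncomputable def modifyPolicy (k : Fin N)
    (σ : (h : Fin H) → Hist S ((j : Fin N) → A j) h.1 → ((j : Fin N) → A j) → ℝ)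
    (φ : (h : Fin H) → Hist S ((j : Fin N) → A j) h.1 → A k → A k → ℝ) :
    (h : Fin H) → Hist S ((j : Fin N) → A j) h.1 → ((j : Fin N) → A j) → ℝ :=
  fun h hist a => ∑ b : A k, σ h hist (Function.update a k b) * φ h hist b (a k)

/-- A history-dependent stochastic policy for a single agent `k`. -/
def IsHistPolicy {k : Fin N}
    (ρ : (h : Fin H) → Hist S ((j : Fin N) → A j) h.1 → A k → ℝ) : Prop :=
  ∀ h hist, (∀ a, 0 ≤ ρ h hist a) ∧ ∑ a, ρ h hist a = 1

/-- The joint policy in which agent `k` unilaterally deviates to the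
history-dependent policy `ρ` while every other agent `j ≠ k` plays `π j`. -/
noncomputable def deviateHist (k : Fin N)
    (π : (j : Fin N) → Fin H → S → A j → ℝ)
    (ρ : (h : Fin H) → Hist S ((j : Fin N) → A j) h.1 → A k → ℝ) :
    (h : Fin H) → Hist S ((j : Fin N) → A j) h.1 → ((j : Fin N) → A j) → ℝ :=
  fun h hist a =>
    ρ h hist (a k) * ∏ j ∈ Finset.univ.erase k, π j h (lastState h.1 hist) (a j)

/-- **Farkas' lemma** for finitely many linear functionals on a real vector space. -/
theorem exists_nonneg_sum_eq_of_forall_nonpos {ι V : Type*} [AddCommGroup V] [Module ℝ V]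
    (s : Finset ι) (f : ι → V →ₗ[ℝ] ℝ) (g : V →ₗ[ℝ] ℝ)
    (hfg : ∀ x, (∀ i ∈ s, f i x ≤ 0) → g x ≤ 0) :
    ∃ w : ι → ℝ, (∀ i, 0 ≤ w i) ∧ ∀ x, g x = ∑ i ∈ s, w i * f i x := by
  classical
  induction s using Finset.induction_on generalizing f g with
  | empty =>
    refine ⟨0, fun _ => le_rfl, fun x => ?_⟩
    have h₁ := hfg x (by simp)
    have h₂ := hfg (-x) (by simp)
    rw [map_neg] at h₂
    rw [Finset.sum_empty]
    linarith
  | insert k s hk ih =>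
    by_cases hs : ∀ x, (∀ i ∈ s, f i x ≤ 0) → g x ≤ 0
    · obtain ⟨w, hw, hg⟩ := ih f g hs
      refine ⟨Function.update w k 0, fun i => ?_, fun x => ?_⟩
      · rcases eq_or_ne i k with rfl | hi
        · simp
        · simpa [hi] using hw i
      · rw [Finset.sum_insert hk, hg x]
        simp only [Function.update_self, zero_mul, zero_add]
        refine Finset.sum_congr rfl fun i hi => ?_
        rw [Function.update_of_ne (ne_of_mem_of_not_mem hi hk)]
    · push Not at hs
      obtain ⟨y, hy, hgy⟩ := hs
      have hky : 0 < f k y := by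
        by_contra! hle
        exact absurd (hfg y (by simpa [hle] using hy)) (not_le.2 hgy)
      have hproj : ∀ l : V →ₗ[ℝ] ℝ, ∀ x,
          (l - (l y / f k y) • f k) x = l (x - (f k x / f k y) • y) := by
        intro l x
        simp only [LinearMap.sub_apply, LinearMap.smul_apply, map_sub, map_smul, smul_eq_mul]
        ring
      obtain ⟨w, hw, hg⟩ := ih (fun i => f i - (f i y / f k y) • f k)
        (g - (g y / f k y) • f k) (by
          intro x hx
          rw [hproj]
          refine hfg _ fun i hi => ?_
          rcases Finset.mem_insert.1 hi with rfl | hi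
          · simp [hky.ne']
          · rw [← hproj]
            exact hx i hi)
      refine ⟨Function.update w k (g y / f k y - ∑ i ∈ s, w i * (f i y / f k y)),
        fun i => ?_, fun x => ?_⟩
      · rcases eq_or_ne i k with rfl | hi
        · rw [Function.update_self]
          have : ∑ j ∈ s, w j * (f j y / f i y) ≤ 0 := Finset.sum_nonpos fun j hj =>
            mul_nonpos_of_nonneg_of_nonpos (hw j) (div_nonpos_of_nonpos_of_nonneg (hy j hj) hky.le)
          have := (div_pos hgy hky).le
          linarith
        · simpa [hi] using hw i
      · have hgx := hg x
        rw [Finset.sum_insert hk, Function.update_self]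
        have hcongr : ∑ i ∈ s, Function.update w k
            (g y / f k y - ∑ i ∈ s, w i * (f i y / f k y)) i * f i x = ∑ i ∈ s, w i * f i x :=
          Finset.sum_congr rfl fun i hi => by
            rw [Function.update_of_ne (ne_of_mem_of_not_mem hi hk)]
        rw [hcongr]
        simp only [LinearMap.sub_apply, LinearMap.smul_apply, smul_eq_mul, mul_sub,
          Finset.sum_sub_distrib, ← mul_assoc, ← Finset.sum_mul] at hgx
        linarith

/-- A theorem of the alternative: either some strictly positive functional is nonpositive on
all of the vectors `d k`, or a nonnegative combination of them is nonnegative and nonzero. -/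
theorem exists_pos_functional_or_nonneg_combination {ι κ : Type*} [Fintype ι] [Fintype κ]
    (d : κ → ι → ℝ) :
    (∃ l : ι → ℝ, (∀ i, 0 < l i) ∧ ∀ k, ∑ i, l i * d k i ≤ 0) ∨
    ∃ w : κ → ℝ, (∀ k, 0 ≤ w k) ∧ (∀ i, 0 ≤ ∑ k, w k * d k i) ∧
      ∃ i, 0 < ∑ k, w k * d k i := by
  classical
  by_cases hall : ∀ m, ∃ l : ι → ℝ, (∀ i, 0 ≤ l i) ∧ 0 < l m ∧ ∀ k, ∑ i, l i * d k i ≤ 0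
  · left
    choose l hl hpos hd using hall
    refine ⟨fun i => ∑ m, l m i, fun i => ?_, fun k => ?_⟩
    · exact (hpos i).trans_le
        (Finset.single_le_sum (f := fun m => l m i) (fun m _ => hl m i) (Finset.mem_univ i))
    · simp only [Finset.sum_mul]
      rw [Finset.sum_comm]
      exact Finset.sum_nonpos fun m _ => hd m k
  · right
    push Not at hall
    obtain ⟨m, hm⟩ := hall
    let f : κ ⊕ ι → (ι → ℝ) →ₗ[ℝ] ℝ :=
      Sum.elim (fun k => ∑ i, d k i • LinearMap.proj i) (fun i => -LinearMap.proj i)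
    have hfl : ∀ k (x : ι → ℝ), f (Sum.inl k) x = ∑ i, x i * d k i := by
      intro k x
      simp [f, LinearMap.sum_apply, mul_comm]
    have hfr : ∀ i (x : ι → ℝ), f (Sum.inr i) x = -x i := fun i x => rfl
    obtain ⟨w, hw, hg⟩ := exists_nonneg_sum_eq_of_forall_nonpos Finset.univ f
      (LinearMap.proj m) (by
        intro x hx
        by_contra! hpos
        obtain ⟨k, hk⟩ := hm x (fun i => by
          have := hx (Sum.inr i) (Finset.mem_univ _)
          rw [hfr] at this
          linarith) hpos
        have := hx (Sum.inl k) (Finset.mem_univ _)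
        rw [hfl] at this
        linarith)
    have hcoord : ∀ i, ∑ k, w (Sum.inl k) * d k i =
        (Pi.single i 1 : ι → ℝ) m + w (Sum.inr i) := by
      intro i
      have := hg (Pi.single i 1)
      simp only [Fintype.sum_sum_type, hfl, hfr, LinearMap.proj_apply] at this
      simp only [Pi.single_apply, ite_mul, one_mul, zero_mul, Finset.sum_ite_eq',
        Finset.mem_univ, if_true, mul_neg, mul_ite, mul_one, mul_zero,
        Finset.sum_neg_distrib] at this ⊢
      linarith
    refine ⟨fun k => w (Sum.inl k), fun k => hw _, fun i => ?_, m, ?_⟩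
    · rw [hcoord i]
      refine add_nonneg ?_ (hw _)
      rw [Pi.single_apply]
      split_ifs <;> norm_num
    · rw [hcoord m, Pi.single_eq_same]
      linarith [hw (Sum.inr m)]

instance Hist.instFinite {S JA : Type} [Finite S] [Finite JA] : ∀ h, Finite (Hist S JA h)
  | 0 => inferInstanceAs (Finite S)
  | h + 1 =>
    have := Hist.instFinite (S := S) (JA := JA) h
    inferInstanceAs (Finite (Hist S JA h × JA × S))

theorem VvecH_of_lt (G : MOMG N M H S A) (j : Fin N)
    (σ : (h : Fin H) → Hist S ((j' : Fin N) → A j') h.1 → ((j' : Fin N) → A j') → ℝ)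
    {h : ℕ} (hlt : h < H) (hist : Hist S ((j' : Fin N) → A j') h) (i : Fin M) :
    VvecH G j σ h hist i = ∑ a : (j' : Fin N) → A j', σ ⟨h, hlt⟩ hist a *
      (G.r j ⟨h, hlt⟩ (lastState h hist) a i +
        ∑ s', G.P ⟨h, hlt⟩ (lastState h hist) a s' *
          VvecH G j σ (h + 1) (hist, a, s') i) := by
  rw [VvecH, dif_pos hlt]

theorem VvecH_of_le (G : MOMG N M H S A) (j : Fin N)
    (σ : (h : Fin H) → Hist S ((j' : Fin N) → A j') h.1 → ((j' : Fin N) → A j') → ℝ)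
    {h : ℕ} (hle : H ≤ h) (hist : Hist S ((j' : Fin N) → A j') h) (i : Fin M) :
    VvecH G j σ h hist i = 0 := by
  rw [VvecH, dif_neg (not_lt.2 hle)]

/-- The value from step `h` on depends only on the policy from step `h` on. -/
theorem VvecH_congr (G : MOMG N M H S A) (j : Fin N)
    {σ τ : (h : Fin H) → Hist S ((j' : Fin N) → A j') h.1 → ((j' : Fin N) → A j') → ℝ} (n : ℕ) :
    ∀ h, n + h = H → (∀ m : Fin H, h ≤ m.1 → σ m = τ m) →
      VvecH G j σ h = VvecH G j τ h := by
  induction n with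
  | zero =>
    intro h hh _
    funext hist i
    rw [VvecH_of_le G j σ (by omega), VvecH_of_le G j τ (by omega)]
  | succ n ih =>
    intro h hh hστ
    funext hist i
    have hlt : h < H := by omega
    rw [VvecH_of_lt G j σ hlt, VvecH_of_lt G j τ hlt, hστ ⟨h, hlt⟩ le_rfl,
      ih (h + 1) (by omega) fun m hm => hστ m (by omega)]

/-- Changing a modification at step `h` does not change the values from step `h + 1` on. -/
theorem VvecH_modifyPolicy_update (G : MOMG N M H S A) (j : Fin N)
    (σ : (h : Fin H) → Hist S ((j' : Fin N) → A j') h.1 → ((j' : Fin N) → A j') → ℝ)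
    (φ : (h : Fin H) → Hist S ((j' : Fin N) → A j') h.1 → A j → A j → ℝ) {h : ℕ} (hlt : h < H)
    (ψ : Hist S ((j' : Fin N) → A j') h → A j → A j → ℝ) :
    VvecH G j (modifyPolicy j σ (Function.update φ ⟨h, hlt⟩ ψ)) (h + 1) =
      VvecH G j (modifyPolicy j σ φ) (h + 1) := by
  refine VvecH_congr G j (H - (h + 1)) (h + 1) (by omega) fun m hm => ?_
  have hne : m ≠ ⟨h, hlt⟩ := by
    rintro rfl
    simp at hm
  funext hist a
  simp only [modifyPolicy, Function.update_of_ne hne]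

omit [Fintype S] in
theorem modifyPolicy_update_self (j : Fin N)
    (σ : (h : Fin H) → Hist S ((j' : Fin N) → A j') h.1 → ((j' : Fin N) → A j') → ℝ)
    (φ : (h : Fin H) → Hist S ((j' : Fin N) → A j') h.1 → A j → A j → ℝ) {h : ℕ} (hlt : h < H)
    (ψ : Hist S ((j' : Fin N) → A j') h → A j → A j → ℝ)
    (hist : Hist S ((j' : Fin N) → A j') h) (a : (j' : Fin N) → A j') :
    modifyPolicy j σ (Function.update φ ⟨h, hlt⟩ ψ) ⟨h, hlt⟩ hist a =
      ∑ b : A j, σ ⟨h, hlt⟩ hist (Function.update a j b) * ψ hist b (a j) := by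
  simp only [modifyPolicy, Function.update_self]

omit [Fintype S] in
theorem IsModification.update {j : Fin N}
    {φ : (h : Fin H) → Hist S ((j' : Fin N) → A j') h.1 → A j → A j → ℝ}
    (hφ : IsModification φ) {h : Fin H} {ψ : Hist S ((j' : Fin N) → A j') h.1 → A j → A j → ℝ}
    (hψ : ∀ hist b, (∀ a, 0 ≤ ψ hist b a) ∧ ∑ a, ψ hist b a = 1) :
    IsModification (Function.update φ h ψ) := by
  intro m
  rcases eq_or_ne m h with rfl | hne
  · simpa only [Function.update_self] using hψ
  · simpa only [Function.update_of_ne hne] using hφ m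

omit [Fintype S] in
theorem modifyPolicy_nonneg {j : Fin N}
    {σ : (h : Fin H) → Hist S ((j' : Fin N) → A j') h.1 → ((j' : Fin N) → A j') → ℝ}
    (hσ : IsHistJointPolicy σ)
    {φ : (h : Fin H) → Hist S ((j' : Fin N) → A j') h.1 → A j → A j → ℝ}
    (hφ : IsModification φ) (h : Fin H) (hist : Hist S ((j' : Fin N) → A j') h.1)
    (a : (j' : Fin N) → A j') : 0 ≤ modifyPolicy j σ φ h hist a :=
  Finset.sum_nonneg fun b _ => mul_nonneg ((hσ h hist).1 _) ((hφ h hist b).1 _)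

/-- Two modifications can be mixed, with weights depending on the history at step `h`. -/
theorem exists_modification_mix (G : MOMG N M H S A) (j : Fin N)
    {σ : (h : Fin H) → Hist S ((j' : Fin N) → A j') h.1 → ((j' : Fin N) → A j') → ℝ}
    (hσ : IsHistJointPolicy σ)
    {φ₁ φ₂ : (h : Fin H) → Hist S ((j' : Fin N) → A j') h.1 → A j → A j → ℝ}
    (hφ₁ : IsModification φ₁) (hφ₂ : IsModification φ₂) (n : ℕ) :
    ∀ h, n + h = H → ∀ t : Hist S ((j' : Fin N) → A j') h → ℝ, (∀ x, 0 ≤ t x) →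
      (∀ x, t x ≤ 1) →
      ∃ φ : (h : Fin H) → Hist S ((j' : Fin N) → A j') h.1 → A j → A j → ℝ,
        IsModification φ ∧ ∀ hist i, VvecH G j (modifyPolicy j σ φ) h hist i =
          t hist * VvecH G j (modifyPolicy j σ φ₁) h hist i +
            (1 - t hist) * VvecH G j (modifyPolicy j σ φ₂) h hist i := by
  induction n with
  | zero =>
    intro h hh t _ _
    refine ⟨φ₁, hφ₁, fun hist i => ?_⟩
    simp only [VvecH_of_le G j _ (show H ≤ h by omega), mul_zero, add_zero]
  | succ n ih =>
    intro h hh t ht₀ ht₁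
    have hlt : h < H := by omega
    set p₁ := modifyPolicy j σ φ₁ ⟨h, hlt⟩ with hp₁
    set p₂ := modifyPolicy j σ φ₂ ⟨h, hlt⟩ with hp₂
    have hn₁ : ∀ x a, 0 ≤ t x * p₁ x a := fun x a =>
      mul_nonneg (ht₀ x) (modifyPolicy_nonneg hσ hφ₁ _ _ _)
    have hn₂ : ∀ x a, 0 ≤ (1 - t x) * p₂ x a := fun x a =>
      mul_nonneg (sub_nonneg.2 (ht₁ x)) (modifyPolicy_nonneg hσ hφ₂ _ _ _)
    let u : Hist S ((j' : Fin N) → A j') h → ((j' : Fin N) → A j') → ℝ := fun x a =>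
      t x * p₁ x a / (t x * p₁ x a + (1 - t x) * p₂ x a)
    have hu : ∀ x a, (t x * p₁ x a + (1 - t x) * p₂ x a) * u x a = t x * p₁ x a := by
      intro x a
      rcases eq_or_ne (t x * p₁ x a + (1 - t x) * p₂ x a) 0 with h0 | h0
      · have := hn₁ x a
        have := hn₂ x a
        rw [h0, zero_mul]
        linarith
      · exact mul_div_cancel₀ _ h0
    obtain ⟨φ, hφ, hV⟩ := ih (h + 1) (by omega) (fun x => u x.1 x.2.1)
      (fun x => div_nonneg (hn₁ _ _) (add_nonneg (hn₁ _ _) (hn₂ _ _)))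
      (fun x => div_le_one_of_le₀ (le_add_of_nonneg_right (hn₂ _ _))
        (add_nonneg (hn₁ _ _) (hn₂ _ _)))
    let ψ : Hist S ((j' : Fin N) → A j') h → A j → A j → ℝ := fun x b a =>
      t x * φ₁ ⟨h, hlt⟩ x b a + (1 - t x) * φ₂ ⟨h, hlt⟩ x b a
    refine ⟨Function.update φ ⟨h, hlt⟩ ψ, hφ.update fun x b => ⟨fun a => ?_, ?_⟩,
      fun hist i => ?_⟩
    · exact add_nonneg (mul_nonneg (ht₀ x) ((hφ₁ _ _ _).1 a))
        (mul_nonneg (sub_nonneg.2 (ht₁ x)) ((hφ₂ _ _ _).1 a))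
    · simp only [ψ, Finset.sum_add_distrib, ← Finset.mul_sum]
      rw [(hφ₁ ⟨h, hlt⟩ x b).2, (hφ₂ ⟨h, hlt⟩ x b).2]
      ring
    · rw [VvecH_of_lt G j _ hlt, VvecH_of_lt G j _ hlt, VvecH_of_lt G j _ hlt,
        VvecH_modifyPolicy_update, Finset.mul_sum, Finset.mul_sum, ← Finset.sum_add_distrib]
      refine Finset.sum_congr rfl fun a _ => ?_
      have hq : modifyPolicy j σ (Function.update φ ⟨h, hlt⟩ ψ) ⟨h, hlt⟩ hist a =
          t hist * p₁ hist a + (1 - t hist) * p₂ hist a := by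
        rw [modifyPolicy_update_self]
        simp only [hp₁, hp₂, modifyPolicy, ψ, Finset.mul_sum]
        rw [← Finset.sum_add_distrib]
        exact Finset.sum_congr rfl fun b _ => by ring
      have hsum : ∑ s', G.P ⟨h, hlt⟩ (lastState h hist) a s' *
            VvecH G j (modifyPolicy j σ φ) (h + 1) (hist, a, s') i =
          u hist a * ∑ s', G.P ⟨h, hlt⟩ (lastState h hist) a s' *
              VvecH G j (modifyPolicy j σ φ₁) (h + 1) (hist, a, s') i +
            (1 - u hist a) * ∑ s', G.P ⟨h, hlt⟩ (lastState h hist) a s' *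
              VvecH G j (modifyPolicy j σ φ₂) (h + 1) (hist, a, s') i := by
        rw [Finset.mul_sum, Finset.mul_sum, ← Finset.sum_add_distrib]
        refine Finset.sum_congr rfl fun s' _ => ?_
        linear_combination G.P ⟨h, hlt⟩ (lastState h hist) a s' * hV (hist, a, s') i
      rw [hq, hsum]
      linear_combination (∑ s', G.P ⟨h, hlt⟩ (lastState h hist) a s' *
          VvecH G j (modifyPolicy j σ φ₁) (h + 1) (hist, a, s') i -
        ∑ s', G.P ⟨h, hlt⟩ (lastState h hist) a s' *
          VvecH G j (modifyPolicy j σ φ₂) (h + 1) (hist, a, s') i) * hu hist a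

/-- The value vectors achievable by the modifications of agent `j` form a convex set. -/
theorem convex_modification_values (G : MOMG N M H S A) (j : Fin N)
    {σ : (h : Fin H) → Hist S ((j' : Fin N) → A j') h.1 → ((j' : Fin N) → A j') → ℝ}
    (hσ : IsHistJointPolicy σ) (s1 : S) :
    Convex ℝ {v : Fin M → ℝ |
      ∃ φ : (h : Fin H) → Hist S ((j' : Fin N) → A j') h.1 → A j → A j → ℝ,
        IsModification φ ∧ VvecH G j (modifyPolicy j σ φ) 0 s1 = v} := by
  rintro _ ⟨φ₁, hφ₁, rfl⟩ _ ⟨φ₂, hφ₂, rfl⟩ a b ha hb hab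
  obtain ⟨φ, hφ, hV⟩ := exists_modification_mix G j hσ hφ₁ hφ₂ H 0 (by omega) (fun _ => a)
    (fun _ => ha) (fun _ => by linarith)
  refine ⟨φ, hφ, funext fun i => ?_⟩
  refine (hV s1 i).trans ?_
  rw [← hab, add_sub_cancel_left]
  rfl

/-- The modification that deterministically replaces `b` by `d h hist b`. -/
noncomputable def detModification {k : Fin N}
    (d : (h : Fin H) → Hist S ((j : Fin N) → A j) h.1 → A k → A k) :
    (h : Fin H) → Hist S ((j : Fin N) → A j) h.1 → A k → A k → ℝ :=
  fun h hist b => open Classical in Pi.single (d h hist b) 1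

omit [Fintype S] in
theorem isModification_detModification {k : Fin N}
    (d : (h : Fin H) → Hist S ((j : Fin N) → A j) h.1 → A k → A k) :
    IsModification (detModification d) := by
  classical
  intro h hist b
  refine ⟨fun a => ?_, ?_⟩
  · simp only [detModification, Pi.single_apply]
    split_ifs <;> norm_num
  · simp [detModification, Pi.single_apply]

omit [Fintype S] [(j : Fin N) → Fintype (A j)] in
theorem detModification_update {k : Fin N}
    (d : (h : Fin H) → Hist S ((j : Fin N) → A j) h.1 → A k → A k) (h : Fin H)
    (e : Hist S ((j : Fin N) → A j) h.1 → A k → A k) :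
    detModification (Function.update d h e) =
      Function.update (detModification d) h
        (fun hist b => open Classical in Pi.single (e hist b) 1) := by
  funext m hist b
  rcases eq_or_ne m h with rfl | hne
  · simp only [detModification, Function.update_self]
  · simp only [detModification, Function.update_of_ne hne]

theorem sum_mul_VvecH_of_lt (G : MOMG N M H S A) (j : Fin N)
    (σ : (h : Fin H) → Hist S ((j' : Fin N) → A j') h.1 → ((j' : Fin N) → A j') → ℝ)
    (l : Fin M → ℝ) {h : ℕ} (hlt : h < H) (hist : Hist S ((j' : Fin N) → A j') h) :
    ∑ i, l i * VvecH G j σ h hist i = ∑ a : (j' : Fin N) → A j', σ ⟨h, hlt⟩ hist a *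
      (∑ i, l i * G.r j ⟨h, hlt⟩ (lastState h hist) a i +
        ∑ s', G.P ⟨h, hlt⟩ (lastState h hist) a s' *
          ∑ i, l i * VvecH G j σ (h + 1) (hist, a, s') i) := by
  simp only [VvecH_of_lt G j σ hlt, Finset.mul_sum, mul_add, Finset.sum_add_distrib]
  congr 1
  · rw [Finset.sum_comm]
    exact Finset.sum_congr rfl fun a _ => Finset.sum_congr rfl fun i _ => by ring
  · rw [Finset.sum_comm]
    refine Finset.sum_congr rfl fun a _ => ?_
    rw [Finset.sum_comm]
    exact Finset.sum_congr rfl fun s' _ => Finset.sum_congr rfl fun i _ => by ring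

/-- The expectation of a function of the modified action, sorted by the recommended and the
replacement action of agent `j`. -/
theorem sum_modified_mul_eq (j : Fin N) (p : ((j' : Fin N) → A j') → ℝ) (ψ : A j → A j → ℝ)
    (q : ((j' : Fin N) → A j') → ℝ) [DecidableEq (A j)] :
    ∑ a, (∑ b, p (Function.update a j b) * ψ b (a j)) * q a =
      ∑ b, ∑ c, ψ b c * ∑ a with a j = c, p (Function.update a j b) * q a := by
  simp only [Finset.sum_mul]
  rw [Finset.sum_comm]
  refine Finset.sum_congr rfl fun b _ => ?_
  rw [← Finset.sum_fiberwise Finset.univ (fun a : (j' : Fin N) → A j' => a j)]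
  refine Finset.sum_congr rfl fun c _ => ?_
  rw [Finset.mul_sum]
  refine Finset.sum_congr rfl fun a ha => ?_
  rw [(Finset.mem_filter.1 ha).2]
  ring

/-- Every linear scalarization is maximized, over all modifications, by a deterministic one. -/
theorem exists_detModification_optimal [∀ j, Nonempty (A j)] (G : MOMG N M H S A) (j : Fin N)
    {σ : (h : Fin H) → Hist S ((j' : Fin N) → A j') h.1 → ((j' : Fin N) → A j') → ℝ}
    (hσ : IsHistJointPolicy σ) (l : Fin M → ℝ) (n : ℕ) :
    ∀ h, n + h = H → ∃ d : (h : Fin H) → Hist S ((j' : Fin N) → A j') h.1 → A j → A j,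
      ∀ φ : (h : Fin H) → Hist S ((j' : Fin N) → A j') h.1 → A j → A j → ℝ,
        IsModification φ → ∀ hist,
          ∑ i, l i * VvecH G j (modifyPolicy j σ φ) h hist i ≤
            ∑ i, l i * VvecH G j (modifyPolicy j σ (detModification d)) h hist i := by
  classical
  induction n with
  | zero =>
    intro h hh
    refine ⟨fun _ _ b => b, fun φ _ hist => ?_⟩
    simp only [VvecH_of_le G j _ (show H ≤ h by omega), le_refl]
  | succ n ih =>
    intro h hh
    have hlt : h < H := by omega
    obtain ⟨d, hd⟩ := ih (h + 1) (by omega)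
    let q : Hist S ((j' : Fin N) → A j') h → ((j' : Fin N) → A j') → ℝ := fun hist a =>
      ∑ i, l i * G.r j ⟨h, hlt⟩ (lastState h hist) a i +
        ∑ s', G.P ⟨h, hlt⟩ (lastState h hist) a s' *
          ∑ i, l i * VvecH G j (modifyPolicy j σ (detModification d)) (h + 1) (hist, a, s') i
    let Q : Hist S ((j' : Fin N) → A j') h → A j → A j → ℝ := fun hist b c =>
      ∑ a with a j = c, σ ⟨h, hlt⟩ hist (Function.update a j b) * q hist a
    choose e he using fun hist b => Finite.exists_max (Q hist b)
    refine ⟨Function.update d ⟨h, hlt⟩ e, fun φ hφ hist => ?_⟩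
    calc ∑ i, l i * VvecH G j (modifyPolicy j σ φ) h hist i
        ≤ ∑ a, modifyPolicy j σ φ ⟨h, hlt⟩ hist a * q hist a := by
          rw [sum_mul_VvecH_of_lt G j _ l hlt]
          refine Finset.sum_le_sum fun a _ =>
            mul_le_mul_of_nonneg_left ?_ (modifyPolicy_nonneg hσ hφ _ _ _)
          refine add_le_add_right (Finset.sum_le_sum fun s' _ => ?_) _
          exact mul_le_mul_of_nonneg_left (hd φ hφ _) (G.P_nonneg _ _ _ _)
      _ = ∑ b, ∑ c, φ ⟨h, hlt⟩ hist b c * Q hist b c :=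
          sum_modified_mul_eq j (σ ⟨h, hlt⟩ hist) (φ ⟨h, hlt⟩ hist) (q hist)
      _ ≤ ∑ b, Q hist b (e hist b) := by
          refine Finset.sum_le_sum fun b _ => ?_
          calc ∑ c, φ ⟨h, hlt⟩ hist b c * Q hist b c
              ≤ ∑ c, φ ⟨h, hlt⟩ hist b c * Q hist b (e hist b) :=
                Finset.sum_le_sum fun c _ =>
                  mul_le_mul_of_nonneg_left (he hist b c) ((hφ _ _ _).1 c)
            _ = Q hist b (e hist b) := by
                rw [← Finset.sum_mul, (hφ ⟨h, hlt⟩ hist b).2, one_mul]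
      _ = ∑ b, ∑ c, (Pi.single (e hist b) 1 : A j → ℝ) c * Q hist b c := by
          simp [Pi.single_apply]
      _ = ∑ a, (∑ b, σ ⟨h, hlt⟩ hist (Function.update a j b) *
            (Pi.single (e hist b) 1 : A j → ℝ) (a j)) * q hist a :=
          (sum_modified_mul_eq j (σ ⟨h, hlt⟩ hist)
            (fun b => (Pi.single (e hist b) 1 : A j → ℝ)) (q hist)).symm
      _ = ∑ i, l i * VvecH G j (modifyPolicy j σ
            (detModification (Function.update d ⟨h, hlt⟩ e))) h hist i := by
          rw [sum_mul_VvecH_of_lt G j _ l hlt, detModification_update,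
            VvecH_modifyPolicy_update]
          refine Finset.sum_congr rfl fun a _ => ?_
          rw [modifyPolicy_update_self]

/-- If no modification of agent `j` Pareto dominates `v`, then some strictly positive
scalarization of the value is maximized at `v`. -/
theorem exists_openSimplex_supporting [∀ j, Nonempty (A j)] (hM : 1 ≤ M)
    (G : MOMG N M H S A) (j : Fin N)
    {σ : (h : Fin H) → Hist S ((j' : Fin N) → A j') h.1 → ((j' : Fin N) → A j') → ℝ}
    (hσ : IsHistJointPolicy σ) (s1 : S) (v : Fin M → ℝ)
    (hv : ∀ φ : (h : Fin H) → Hist S ((j' : Fin N) → A j') h.1 → A j → A j → ℝ,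
      IsModification φ → ¬ ParetoDom (VvecH G j (modifyPolicy j σ φ) 0 s1) v) :
    ∃ l : Fin M → ℝ, InOpenSimplex l ∧
      ∀ φ : (h : Fin H) → Hist S ((j' : Fin N) → A j') h.1 → A j → A j → ℝ,
        IsModification φ →
          ∑ i, l i * VvecH G j (modifyPolicy j σ φ) 0 s1 i ≤ ∑ i, l i * v i := by
  have := Fintype.ofFinite
    ((h : Fin H) → Hist S ((j' : Fin N) → A j') h.1 → A j → A j)
  let V := fun d : (h : Fin H) → Hist S ((j' : Fin N) → A j') h.1 → A j → A j =>
    VvecH G j (modifyPolicy j σ (detModification d)) 0 s1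
  rcases exists_pos_functional_or_nonneg_combination (fun d i => V d i - v i) with
    ⟨l, hl, hle⟩ | ⟨w, hw, hge, m, hm⟩
  · have : Nonempty (Fin M) := ⟨⟨0, hM⟩⟩
    have hpos : 0 < ∑ i, l i := Finset.sum_pos (fun i _ => hl i) Finset.univ_nonempty
    refine ⟨fun i => l i / ∑ i, l i, ⟨fun i => div_pos (hl i) hpos, ?_⟩, fun φ hφ => ?_⟩
    · rw [← Finset.sum_div, div_self hpos.ne']
    · simp only [div_mul_eq_mul_div]
      rw [← Finset.sum_div, ← Finset.sum_div]
      refine div_le_div_of_nonneg_right ?_ hpos.le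
      obtain ⟨d, hd⟩ := exists_detModification_optimal G j hσ l H 0 (by omega)
      refine (hd φ hφ s1).trans ?_
      have := hle d
      simpa only [V, mul_sub, Finset.sum_sub_distrib, sub_nonpos] using this
  · exfalso
    have hpos : 0 < ∑ d, w d := by
      refine lt_of_le_of_ne (Finset.sum_nonneg fun d _ => hw d) fun h0 => ?_
      have hw0 := (Finset.sum_eq_zero_iff_of_nonneg fun d _ => hw d).1 h0.symm
      simp [hw0] at hm
    obtain ⟨φ, hφ, hVφ⟩ := (convex_modification_values G j hσ s1).centerMass_mem
      (t := Finset.univ) (z := V) (fun d _ => hw d) hpos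
      (fun d _ => ⟨detModification d, isModification_detModification d, rfl⟩)
    have hval : ∀ i, VvecH G j (modifyPolicy j σ φ) 0 s1 i =
        v i + (∑ d, w d)⁻¹ * ∑ d, w d * (V d i - v i) := by
      intro i
      rw [hVφ]
      simp only [Finset.centerMass, Pi.smul_apply, Finset.sum_apply, smul_eq_mul, mul_sub,
        Finset.sum_sub_distrib, ← Finset.sum_mul]
      rw [inv_mul_cancel_left₀ hpos.ne']
      ring
    refine hv φ hφ ⟨fun i => ?_, m, ?_⟩
    · rw [hval]
      exact le_add_of_nonneg_right (mul_nonneg (inv_nonneg.2 hpos.le) (hge i))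
    · rw [hval]
      exact lt_add_of_pos_right _ (mul_pos (inv_pos.2 hpos) hm)

/-- **PCEs are exactly the ex-ante correlated equilibria of strictly positive
linear scalarizations.** A joint policy `σ` is a Pareto Correlated Equilibrium
of `G` iff there is a preference profile `Λ = (λ^1,…,λ^N)` with every
`λ^k ∈ Δ_M^o` such that for every player `j` and every stochastic modification
`φ_j`, `(λ^j)ᵀ V_{j,1}^{φ_j ∘ σ}(s_1) ≤ (λ^j)ᵀ V_{j,1}^σ(s_1)`, i.e. `σ` is an
ex-ante correlated equilibrium of the scalarized game `G_Λ`. -/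
theorem PCE_iff_scalarized_CE {N M H : ℕ} (hN : 1 ≤ N) (hH : 1 ≤ H) (hM : 1 ≤ M)
    (S : Type) (A : Fin N → Type) [Fintype S] [Nonempty S]
    [∀ j, Fintype (A j)] [∀ j, Nonempty (A j)]
    (G : MOMG N M H S A) (s1 : S)
    (σ : (h : Fin H) → Hist S ((j : Fin N) → A j) h.1 → ((j : Fin N) → A j) → ℝ)
    (hσ : IsHistJointPolicy σ) :
    (∀ j, ∀ φ : (h : Fin H) → Hist S ((j' : Fin N) → A j') h.1 → A j → A j → ℝ,
        IsModification φ →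
        ¬ ParetoDom (fun i => VvecH G j (modifyPolicy j σ φ) 0 s1 i)
          (fun i => VvecH G j σ 0 s1 i))
    ↔ (∃ lam : Fin N → Fin M → ℝ, (∀ k, InOpenSimplex (lam k)) ∧
        ∀ j, ∀ φ : (h : Fin H) → Hist S ((j' : Fin N) → A j') h.1 → A j → A j → ℝ,
          IsModification φ →
          ∑ i, lam j i * VvecH G j (modifyPolicy j σ φ) 0 s1 i ≤
            ∑ i, lam j i * VvecH G j σ 0 s1 i) := by
  constructor
  · intro hP
    choose lam hlam hle using fun j => exists_openSimplex_supporting hM G j hσ s1 _ (hP j)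
    exact ⟨lam, hlam, hle⟩
  · rintro ⟨lam, hlam, hle⟩ j φ hφ ⟨hge, m, hm⟩
    refine (hle j φ hφ).not_gt (Finset.sum_lt_sum (fun i _ => ?_) ⟨m, Finset.mem_univ m, ?_⟩)
    · exact mul_le_mul_of_nonneg_left (hge i) ((hlam j).1 i).le
    · exact mul_lt_mul_of_pos_left hm ((hlam j).1 m)
end
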